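/- Let d ≥ 2 and let V : ℝ^d → ℝ be a nonnegative convex function, and let μ = e^{V(x)} dx. Then μ satisfies the Euclidean isoperimetric inequality: for every bounded open set A ⊂ ℝ^d with smooth boundary, μ(A)^{1 − 1/d} ≤ κ_d · μ⁺(∂A), where κ_d = 1/( d·ω_d^{1/d} ) and ω_d is the Lebesgue measure of the unit ball in ℝ^d. -/

import Mathlib

open MeasureTheory Metric Filter Set
open scoped ENNReal

/-- The (lower outer) surface measure `μ⁺(∂A) = liminf_{ε→0⁺} (μ(A^ε) − μ(A))/ε`,
where `A^ε` is the open `ε`-neighborhood of `A`. -/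
noncomputable def surfaceMeasure {X : Type*} [PseudoEMetricSpace X] [MeasurableSpace X]
    (μ : Measure X) (A : Set X) : ℝ≥0∞ :=
  Filter.liminf (fun ε : ℝ => (μ (Metric.thickening ε A) - μ A) / ENNReal.ofReal ε)
    (nhdsWithin 0 (Set.Ioi 0))

/-- `A` has smooth boundary: near every boundary point, `A` is the sublevel set of a
smooth function with nonvanishing differential. -/
def HasSmoothBoundary {d : ℕ} (A : Set (EuclideanSpace ℝ (Fin d))) : Prop :=
  ∀ x ∈ frontier A, ∃ U : Set (EuclideanSpace ℝ (Fin d)), IsOpen U ∧ x ∈ U ∧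
    ∃ g : EuclideanSpace ℝ (Fin d) → ℝ, ContDiff ℝ (⊤ : ℕ∞) g ∧ (∀ y ∈ U, fderiv ℝ g y ≠ 0) ∧
      A ∩ U = {y | g y < 0} ∩ U

/-- The constant in the Euclidean isoperimetric inequality:
`κ_d = 1 / (d · ω_d^{1/d})` where `ω_d` is the volume of the unit ball of `ℝ^d`. -/
noncomputable def kappa (d : ℕ) : ℝ :=
  1 / (d * (volume (Metric.ball (0 : EuclideanSpace ℝ (Fin d)) 1)).toReal ^ ((1 : ℝ) / d))


set_option linter.unusedSectionVars false
set_option linter.unusedVariables false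

section Transport

variable {d : ℕ} {ι : Type*} [Fintype ι]

/-- Laguerre cell in the closed unit ball. -/
def lcell (x : ι → EuclideanSpace ℝ (Fin d)) (c : ι → ℝ) (i : ι) :
    Set (EuclideanSpace ℝ (Fin d)) :=
  {y | ‖y‖ ≤ 1 ∧ ∀ j, inner ℝ (x j) y - c j ≤ inner ℝ (x i) y - c i}

/-- Strict Laguerre cell. -/
def scell (x : ι → EuclideanSpace ℝ (Fin d)) (c : ι → ℝ) (i : ι) :
    Set (EuclideanSpace ℝ (Fin d)) :=
  {y | ‖y‖ ≤ 1 ∧ ∀ j, j ≠ i → inner ℝ (x j) y - c j < inner ℝ (x i) y - c i}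

/-- The max-affine potential. -/
noncomputable def lpot [Nonempty ι] (x : ι → EuclideanSpace ℝ (Fin d)) (c : ι → ℝ)
    (y : EuclideanSpace ℝ (Fin d)) : ℝ :=
  Finset.univ.sup' Finset.univ_nonempty (fun i => inner ℝ (x i) y - c i)

lemma lpot_ge [Nonempty ι] (x : ι → EuclideanSpace ℝ (Fin d)) (c : ι → ℝ)
    (y : EuclideanSpace ℝ (Fin d)) (i : ι) : inner ℝ (x i) y - c i ≤ lpot x c y :=
  Finset.le_sup' (fun i => inner ℝ (x i) y - c i) (Finset.mem_univ i)

lemma lpot_le [Nonempty ι] (x : ι → EuclideanSpace ℝ (Fin d)) (c : ι → ℝ)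
    (y : EuclideanSpace ℝ (Fin d)) (a : ℝ) (h : ∀ i, inner ℝ (x i) y - c i ≤ a) :
    lpot x c y ≤ a :=
  Finset.sup'_le _ _ (fun i _ => h i)

lemma lpot_exists [Nonempty ι] (x : ι → EuclideanSpace ℝ (Fin d)) (c : ι → ℝ)
    (y : EuclideanSpace ℝ (Fin d)) : ∃ i, lpot x c y = inner ℝ (x i) y - c i := by
  obtain ⟨i, _, hi⟩ := Finset.exists_mem_eq_sup' (Finset.univ_nonempty (α := ι))
    (fun i => inner ℝ (x i) y - c i)
  exact ⟨i, hi⟩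

lemma lpot_continuous [Nonempty ι] (x : ι → EuclideanSpace ℝ (Fin d)) :
    Continuous (fun q : (ι → ℝ) × EuclideanSpace ℝ (Fin d) => lpot x q.1 q.2) := by
  unfold lpot
  apply Continuous.finset_sup'_apply
  intro i _
  fun_prop

lemma lcell_isClosed (x : ι → EuclideanSpace ℝ (Fin d)) (c : ι → ℝ) (i : ι) :
    IsClosed (lcell x c i) := by
  have : lcell x c i = {y | ‖y‖ ≤ 1} ∩
      ⋂ j, {y | inner ℝ (x j) y - c j ≤ inner ℝ (x i) y - c i} := by
    ext y; simp [lcell]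
  rw [this]
  refine (isClosed_le (by fun_prop) (by fun_prop)).inter (isClosed_iInter fun j => ?_)
  exact isClosed_le (by fun_prop) (by fun_prop)

lemma lcell_convex (x : ι → EuclideanSpace ℝ (Fin d)) (c : ι → ℝ) (i : ι) :
    Convex ℝ (lcell x c i) := by
  intro y hy z hz a b ha hb hab
  refine ⟨?_, fun j => ?_⟩
  · have h := convex_closedBall (0 : EuclideanSpace ℝ (Fin d)) 1
    have := h (x := y) (by simpa using hy.1) (y := z) (by simpa using hz.1) ha hb hab
    simpa using this
  · have h1 := hy.2 j
    have h2 := hz.2 j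
    simp only [inner_add_right, inner_smul_right]
    have hb' : b = 1 - a := by linarith
    subst hb'
    nlinarith [mul_le_mul_of_nonneg_left h1 ha, mul_le_mul_of_nonneg_left h2 hb]

lemma lcell_subset (x : ι → EuclideanSpace ℝ (Fin d)) (c : ι → ℝ) (i : ι) :
    lcell x c i ⊆ closedBall 0 1 := by
  intro y hy; simpa using hy.1

lemma lcell_finite (x : ι → EuclideanSpace ℝ (Fin d)) (c : ι → ℝ) (i : ι) :
    volume (lcell x c i) ≠ ∞ :=
  ((measure_mono (lcell_subset x c i)).trans_lt measure_closedBall_lt_top).ne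

/-- Ties form a null set. -/
lemma hyper_null (v : EuclideanSpace ℝ (Fin d)) (hv : v ≠ 0) (a : ℝ) :
    volume {y : EuclideanSpace ℝ (Fin d) | inner ℝ v y = a} = 0 := by
  by_cases hne : ∃ y0 : EuclideanSpace ℝ (Fin d), inner ℝ v y0 = a
  · obtain ⟨y0, hy0⟩ := hne
    have hset : {y : EuclideanSpace ℝ (Fin d) | inner ℝ v y = a} =
        (AffineSubspace.mk' y0 (LinearMap.ker (innerSL ℝ v).toLinearMap) :
          Set (EuclideanSpace ℝ (Fin d))) := by
      ext y
      simp [AffineSubspace.mem_mk', inner_sub_right, hy0, sub_eq_zero]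
    rw [hset]
    apply Measure.addHaar_affineSubspace
    intro htop
    have : (y0 + v) ∈ (AffineSubspace.mk' y0 (LinearMap.ker (innerSL ℝ v).toLinearMap)) := by
      rw [htop]; trivial
    simp [AffineSubspace.mem_mk'] at this
    exact hv this
  · have : {y : EuclideanSpace ℝ (Fin d) | inner ℝ v y = a} = ∅ := by
      ext y; simp; intro h; exact hne ⟨y, h⟩
    rw [this]; simp

lemma ties_ae (x : ι → EuclideanSpace ℝ (Fin d)) (hx : Function.Injective x) (c : ι → ℝ) :
    ∀ᵐ y : EuclideanSpace ℝ (Fin d), ∀ i j, i ≠ j →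
      inner ℝ (x i) y - c i ≠ inner ℝ (x j) y - c j := by
  rw [ae_all_iff]; intro i
  rw [ae_all_iff]; intro j
  by_cases hij : i = j
  · simp [hij]
  · have := hyper_null (x i - x j) (sub_ne_zero.mpr (fun h => hij (hx h))) (c i - c j)
    rw [ae_iff]
    refine measure_mono_null ?_ this
    intro y hy
    simp only [mem_ofPred_eq, Classical.not_imp, not_not] at hy ⊢
    rw [inner_sub_left]; linarith [hy.2]

lemma lcell_ae_scell (x : ι → EuclideanSpace ℝ (Fin d)) (hx : Function.Injective x)
    (c : ι → ℝ) (i : ι) : volume (lcell x c i) ≤ volume (scell x c i) := by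
  apply measure_mono_ae
  filter_upwards [ties_ae x hx c] with y hy hyc
  refine ⟨hyc.1, fun j hj => lt_of_le_of_ne (hyc.2 j) (hy j i hj)⟩

lemma lpot_intOn [Nonempty ι] (x : ι → EuclideanSpace ℝ (Fin d)) (c : ι → ℝ) :
    IntegrableOn (lpot x c) (closedBall 0 1) :=
  (((lpot_continuous x).comp (Continuous.prodMk_right c)).continuousOn).integrableOn_compact
    (isCompact_closedBall _ _)

lemma const_intOn (t : ℝ) :
    IntegrableOn (fun _ : EuclideanSpace ℝ (Fin d) => t) (closedBall 0 1) :=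
  continuous_const.continuousOn.integrableOn_compact (isCompact_closedBall _ _)

/-- dual functional -/
noncomputable def dualG [Nonempty ι] (x : ι → EuclideanSpace ℝ (Fin d)) (m c : ι → ℝ) : ℝ :=
  (∫ y in closedBall (0 : EuclideanSpace ℝ (Fin d)) 1, lpot x c y) + ∑ i, m i * c i

lemma dualG_continuous [Nonempty ι] (x : ι → EuclideanSpace ℝ (Fin d)) (m : ι → ℝ) :
    Continuous (dualG x m) := by
  unfold dualG
  refine Continuous.add ?_ (by fun_prop)
  have := continuous_parametric_integral_of_continuous (μ := volume) (f := fun c y => lpot x c y)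
    (lpot_continuous x) (isCompact_closedBall (0 : EuclideanSpace ℝ (Fin d)) 1)
  exact this

lemma dualG_shift [Nonempty ι] (x : ι → EuclideanSpace ℝ (Fin d)) (m c : ι → ℝ)
    (hm : ∑ i, m i = volume.real (closedBall (0 : EuclideanSpace ℝ (Fin d)) 1)) (s : ℝ) :
    dualG x m (fun i => c i - s) = dualG x m c := by
  have h1 : ∀ y, lpot x (fun i => c i - s) y = lpot x c y + s := by
    intro y
    apply le_antisymm
    · apply lpot_le; intro i; linarith [lpot_ge x c y i]
    · have : lpot x c y ≤ lpot x (fun i => c i - s) y - s := by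
        apply lpot_le; intro i; linarith [lpot_ge x (fun i => c i - s) y i]
      linarith
  unfold dualG
  simp_rw [h1]
  rw [integral_add (lpot_intOn x c) (const_intOn s)]
  simp only [integral_const, smul_eq_mul, mul_sub, Finset.sum_sub_distrib, ← Finset.sum_mul, hm]
  simp [Measure.real]

lemma dualG_exists_min [Nonempty ι] (x : ι → EuclideanSpace ℝ (Fin d)) (m : ι → ℝ)
    (hpos : ∀ i, 0 < m i)
    (hm : ∑ i, m i = volume.real (closedBall (0 : EuclideanSpace ℝ (Fin d)) 1)) :
    ∃ c, ∀ c', dualG x m c ≤ dualG x m c' := by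
  set W := volume.real (closedBall (0 : EuclideanSpace ℝ (Fin d)) 1) with hW
  set K : ℝ := ∑ i, ‖x i‖ with hK
  have hKi : ∀ i, ‖x i‖ ≤ K := fun i =>
    Finset.single_le_sum (f := fun i => ‖x i‖) (fun _ _ => norm_nonneg _) (Finset.mem_univ i)
  obtain ⟨i0, hi0⟩ := Finite.exists_min m
  set L : ℝ := max 0 ((dualG x m 0 + K * W) / m i0) with hL
  have hcomp : IsCompact (Set.pi univ (fun _ : ι => Icc (0:ℝ) L)) :=
    isCompact_univ_pi (fun _ => isCompact_Icc)
  have h0 : (0 : ι → ℝ) ∈ (Set.pi univ (fun _ : ι => Icc (0:ℝ) L)) := by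
    intro i _; exact ⟨le_refl _, le_max_left _ _⟩
  obtain ⟨c, hc, hmin⟩ := hcomp.exists_isMinOn ⟨0, h0⟩ (dualG_continuous x m).continuousOn
  refine ⟨c, fun c' => ?_⟩
  obtain ⟨j, hj⟩ := Finite.exists_min c'
  rw [← dualG_shift x m c' hm (c' j)]
  set e : ι → ℝ := fun i => c' i - c' j with he
  have he0 : ∀ i, 0 ≤ e i := fun i => sub_nonneg.mpr (hj i)
  have hej : e j = 0 := by simp [he]
  by_cases hmem : e ∈ (Set.pi univ (fun _ : ι => Icc (0:ℝ) L))
  · exact hmin hmem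
  · have : ∃ k, L < e k := by
      by_contra! hcon
      exact hmem (fun i _ => ⟨he0 i, hcon i⟩)
    obtain ⟨k, hk⟩ := this
    have h1 : dualG x m c ≤ dualG x m 0 := hmin h0
    have h2 : -(K * W) ≤ ∫ y in closedBall (0 : EuclideanSpace ℝ (Fin d)) 1, lpot x e y := by
      have : ∫ y in closedBall (0 : EuclideanSpace ℝ (Fin d)) 1, (-K) ≤
          ∫ y in closedBall (0 : EuclideanSpace ℝ (Fin d)) 1, lpot x e y := by
        apply setIntegral_mono_on (const_intOn _) (lpot_intOn x e) measurableSet_closedBall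
        intro y hy
        have h3 := lpot_ge x e y j
        rw [hej] at h3
        have h4 : |inner ℝ (x j) y| ≤ ‖x j‖ * ‖y‖ := abs_real_inner_le_norm _ _
        have h5 : ‖y‖ ≤ 1 := by simpa using hy
        have h6 : ‖x j‖ * ‖y‖ ≤ K :=
          (mul_le_of_le_one_right (norm_nonneg _) h5).trans (hKi j)
        linarith [neg_abs_le (inner ℝ (x j) y : ℝ)]
      simp only [integral_const, smul_eq_mul] at this
      have hh : (volume.restrict (closedBall (0 : EuclideanSpace ℝ (Fin d)) 1)).real univ = W := by
        simp [hW, Measure.real]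
      rw [hh] at this
      linarith
    have h3 : m k * e k ≤ ∑ i, m i * e i :=
      Finset.single_le_sum (f := fun i => m i * e i)
        (fun i _ => mul_nonneg (hpos i).le (he0 i)) (Finset.mem_univ k)
    have h4 : (dualG x m 0 + K * W) ≤ m i0 * L := by
      have := le_max_right 0 ((dualG x m 0 + K * W) / m i0)
      rw [← hL, div_le_iff₀ (hpos i0)] at this
      linarith
    have hL0 : 0 ≤ L := le_max_left _ _
    have h5 : m i0 * L ≤ m k * e k :=
      mul_le_mul (hi0 k) hk.le hL0 (hpos k).le
    have h6 : dualG x m e = (∫ y in closedBall (0 : EuclideanSpace ℝ (Fin d)) 1, lpot x e y)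
      + ∑ i, m i * e i := rfl
    linarith

lemma dualG_update [Nonempty ι] [DecidableEq ι] (x : ι → EuclideanSpace ℝ (Fin d)) (m c : ι → ℝ)
    (hc : ∀ c', dualG x m c ≤ dualG x m c') (i : ι) (t : ℝ) (ht : 0 < t) :
    volume.real (lcell x (Function.update c i (c i + t)) i) ≤ m i := by
  set c' := Function.update c i (c i + t) with hc'
  have hci : c' i = c i + t := by simp [hc']
  have hcj : ∀ j, j ≠ i → c' j = c j := fun j hj => by simp [hc', hj]
  have hle : ∀ j, c j ≤ c' j := fun j => by
    by_cases h : j = i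
    · subst h; rw [hci]; linarith
    · rw [hcj j h]
  have hmeas : MeasurableSet (lcell x c' i) := (lcell_isClosed x c' i).measurableSet
  have key : ∀ y, lpot x c' y ≤ lpot x c y - (lcell x c' i).indicator (fun _ => t) y := by
    intro y
    by_cases hy : y ∈ lcell x c' i
    · rw [indicator_of_mem hy]
      have : lpot x c' y ≤ inner ℝ (x i) y - c' i := lpot_le _ _ _ _ hy.2
      rw [hci] at this
      linarith [lpot_ge x c y i]
    · rw [indicator_of_notMem hy]
      apply lpot_le; intro j
      linarith [lpot_ge x c y j, hle j]
  have hintg : ∫ y in closedBall (0 : EuclideanSpace ℝ (Fin d)) 1, lpot x c' y ≤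
      (∫ y in closedBall (0 : EuclideanSpace ℝ (Fin d)) 1, lpot x c y)
        - t * volume.real (lcell x c' i) := by
    have hI : IntegrableOn ((lcell x c' i).indicator (fun _ => t))
        (closedBall (0 : EuclideanSpace ℝ (Fin d)) 1) volume :=
      (const_intOn t).indicator hmeas
    have h1 := integral_mono (lpot_intOn x c') ((lpot_intOn x c).sub hI) key
    have h2 := integral_sub (lpot_intOn x c) hI
    simp only [Pi.sub_apply] at h1
    rw [h2, setIntegral_indicator hmeas, inter_eq_self_of_subset_right (lcell_subset x c' i),
      setIntegral_const, smul_eq_mul] at h1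
    linarith
  have hsum : ∑ j, m j * c' j = ∑ j, m j * c j + m i * t := by
    have : ∀ j, m j * c' j = m j * c j + (if j = i then m i * t else 0) := by
      intro j
      by_cases h : j = i
      · subst h; rw [hci]; simp; ring
      · rw [hcj j h]; simp [h]
    simp_rw [this, Finset.sum_add_distrib]; simp
  have := hc c'
  unfold dualG at this
  rw [hsum] at this
  have h3 : t * volume.real (lcell x c' i) ≤ t * m i := by linarith
  exact le_of_mul_le_mul_left h3 ht

lemma scell_le [Nonempty ι] [DecidableEq ι] (x : ι → EuclideanSpace ℝ (Fin d)) (m c : ι → ℝ)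
    (hpos : ∀ i, 0 < m i)
    (hc : ∀ c', dualG x m c ≤ dualG x m c') (i : ι) :
    volume (scell x c i) ≤ ENNReal.ofReal (m i) := by
  set S : ℕ → Set (EuclideanSpace ℝ (Fin d)) :=
    fun n => lcell x (Function.update c i (c i + 1 / ((n : ℝ) + 1))) i with hS
  have hmem : ∀ n y, y ∈ S n ↔ ‖y‖ ≤ 1 ∧ ∀ j, j ≠ i →
      inner ℝ (x j) y - c j ≤ inner ℝ (x i) y - c i - 1 / ((n : ℝ) + 1) := by
    intro n y
    simp only [hS, lcell, mem_ofPred_eq, Function.update_self]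
    refine and_congr_right fun _ => ⟨fun h j hj => ?_, fun h j => ?_⟩
    · have := h j
      rw [Function.update_of_ne hj] at this; linarith
    · by_cases hj : j = i
      · subst hj; simp
      · rw [Function.update_of_ne hj]; linarith [h j hj]
  have hmono : Monotone S := by
    intro a b hab y hy
    rw [hmem] at hy ⊢
    refine ⟨hy.1, fun j hj => (hy.2 j hj).trans ?_⟩
    have : 1 / ((b : ℝ) + 1) ≤ 1 / ((a : ℝ) + 1) := Nat.one_div_le_one_div hab
    linarith
  have hsub : scell x c i ⊆ ⋃ n, S n := by
    intro y hy
    have : ∀ j, ∃ n : ℕ, j ≠ i → 1 / ((n : ℝ) + 1) <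
        (inner ℝ (x i) y - c i) - (inner ℝ (x j) y - c j) := by
      intro j
      by_cases hj : j = i
      · exact ⟨0, fun h => absurd hj h⟩
      · obtain ⟨n, hn⟩ := exists_nat_one_div_lt (sub_pos.mpr (hy.2 j hj))
        exact ⟨n, fun _ => hn⟩
    choose n hn using this
    rw [mem_iUnion]
    refine ⟨∑ j, n j, (hmem _ _).2 ⟨hy.1, fun j hj => ?_⟩⟩
    have h1 : n j ≤ ∑ j, n j := Finset.single_le_sum (f := n) (fun _ _ => Nat.zero_le _)
      (Finset.mem_univ j)
    have h2 : 1 / (((∑ j, n j : ℕ) : ℝ) + 1) ≤ 1 / ((n j : ℝ) + 1) := Nat.one_div_le_one_div h1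
    linarith [hn j hj]
  refine (measure_mono hsub).trans ?_
  rw [hmono.measure_iUnion]
  refine iSup_le fun n => ?_
  have := dualG_update x m c hc i (1 / ((n : ℝ) + 1)) Nat.one_div_pos_of_nat
  rw [← ENNReal.ofReal_toReal (lcell_finite x (Function.update c i (c i + 1 / ((n : ℝ) + 1))) i)]
  exact ENNReal.ofReal_le_ofReal this

theorem transport_exists [Nonempty ι] (x : ι → EuclideanSpace ℝ (Fin d))
    (hx : Function.Injective x) (m : ι → ℝ)
    (hpos : ∀ i, 0 < m i)
    (hm : ∑ i, m i = volume.real (closedBall (0 : EuclideanSpace ℝ (Fin d)) 1)) :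
    ∃ c, ∀ i, volume.real (lcell x c i) = m i := by
  classical
  obtain ⟨c, hc⟩ := dualG_exists_min x m hpos hm
  refine ⟨c, ?_⟩
  have hle : ∀ i, volume.real (lcell x c i) ≤ m i := fun i =>
    ENNReal.toReal_le_of_le_ofReal (hpos i).le
      ((lcell_ae_scell x hx c i).trans (scell_le x m c hpos hc i))
  have hcov : closedBall (0 : EuclideanSpace ℝ (Fin d)) 1 ⊆ ⋃ i, lcell x c i := by
    intro y hy
    obtain ⟨i, hi⟩ := lpot_exists x c y
    rw [mem_iUnion]
    exact ⟨i, by simpa using hy, fun j => hi ▸ lpot_ge x c y j⟩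
  have hsum : ∑ i, m i ≤ ∑ i, volume.real (lcell x c i) := by
    rw [hm]
    refine le_trans ?_ (measureReal_iUnion_fintype_le _)
    exact measureReal_mono hcov
      ((measure_mono (iUnion_subset fun i => lcell_subset x c i)).trans_lt
        measure_closedBall_lt_top).ne
  intro i
  have := (Finset.sum_eq_sum_iff_of_le (fun i _ => hle i)).1
    (le_antisymm (Finset.sum_le_sum fun i _ => hle i) hsum)
  exact this i (Finset.mem_univ i)

end Transport

section Positivity

variable {d : ℕ} {ι : Type*} [Fintype ι]

/-- softmax weights -/
noncomputable def smax (x : ι → EuclideanSpace ℝ (Fin d)) (c : ι → ℝ) (b : ℝ) (i : ι)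
    (y : EuclideanSpace ℝ (Fin d)) : ℝ :=
  Real.exp (b * (inner ℝ (x i) y - c i)) / ∑ j, Real.exp (b * (inner ℝ (x j) y - c j))

lemma smax_den_pos [Nonempty ι] (x : ι → EuclideanSpace ℝ (Fin d)) (c : ι → ℝ) (b : ℝ)
    (y : EuclideanSpace ℝ (Fin d)) : 0 < ∑ j, Real.exp (b * (inner ℝ (x j) y - c j)) :=
  Finset.sum_pos (fun _ _ => Real.exp_pos _) Finset.univ_nonempty

lemma smax_nonneg (x : ι → EuclideanSpace ℝ (Fin d)) (c : ι → ℝ) (b : ℝ) (i : ι)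
    (y : EuclideanSpace ℝ (Fin d)) : 0 ≤ smax x c b i y :=
  div_nonneg (Real.exp_pos _).le (Finset.sum_nonneg fun _ _ => (Real.exp_pos _).le)

lemma smax_sum [Nonempty ι] (x : ι → EuclideanSpace ℝ (Fin d)) (c : ι → ℝ) (b : ℝ)
    (y : EuclideanSpace ℝ (Fin d)) : ∑ i, smax x c b i y = 1 := by
  unfold smax
  rw [← Finset.sum_div, div_self (smax_den_pos x c b y).ne']

lemma smax_le_one [Nonempty ι] (x : ι → EuclideanSpace ℝ (Fin d)) (c : ι → ℝ) (b : ℝ) (i : ι)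
    (y : EuclideanSpace ℝ (Fin d)) : smax x c b i y ≤ 1 := by
  rw [← smax_sum x c b y]
  exact Finset.single_le_sum (f := fun i => smax x c b i y)
    (fun _ _ => smax_nonneg _ _ _ _ _) (Finset.mem_univ i)

lemma smax_contDiff [Nonempty ι] (x : ι → EuclideanSpace ℝ (Fin d)) (c : ι → ℝ) (b : ℝ) (i : ι) :
    ContDiff ℝ 1 (smax x c b i) := by
  unfold smax
  refine ContDiff.div ?_ ?_ (fun y => (smax_den_pos x c b y).ne')
  · have : ContDiff ℝ 1 fun y : EuclideanSpace ℝ (Fin d) => (inner ℝ (x i) y : ℝ) :=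
      contDiff_const.inner ℝ contDiff_id
    exact (contDiff_const.mul (this.sub contDiff_const)).exp
  · refine ContDiff.sum fun j _ => ?_
    have : ContDiff ℝ 1 fun y : EuclideanSpace ℝ (Fin d) => (inner ℝ (x j) y : ℝ) :=
      contDiff_const.inner ℝ contDiff_id
    exact (contDiff_const.mul (this.sub contDiff_const)).exp

lemma smax_lineDeriv [Nonempty ι] (x : ι → EuclideanSpace ℝ (Fin d)) (c : ι → ℝ) (b : ℝ) (i : ι)
    (y v : EuclideanSpace ℝ (Fin d)) :
    lineDeriv ℝ (smax x c b i) y v =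
      b * smax x c b i y * (inner ℝ (x i) v - ∑ j, smax x c b j y * inner ℝ (x j) v) := by
  have hE : ∀ j, HasDerivAt (fun t : ℝ => Real.exp (b * (inner ℝ (x j) (y + t • v) - c j)))
      (b * inner ℝ (x j) v * Real.exp (b * (inner ℝ (x j) y - c j))) 0 := by
    intro j
    have h1 : HasDerivAt (fun t : ℝ => b * (inner ℝ (x j) (y + t • v) - c j))
        (b * inner ℝ (x j) v) 0 := by
      have : (fun t : ℝ => b * (inner ℝ (x j) (y + t • v) - c j)) =
          fun t : ℝ => b * (inner ℝ (x j) y + t * inner ℝ (x j) v - c j) := by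
        ext t; rw [inner_add_right, inner_smul_right]
      rw [this]
      have := ((((hasDerivAt_id (0:ℝ)).mul_const (inner ℝ (x j) v)).const_add
        (inner ℝ (x j) y)).sub_const (c j)).const_mul b
      simpa using this
    have := h1.exp
    simp only [zero_smul, add_zero] at this
    rwa [mul_comm] at this
  have hZ := HasDerivAt.fun_sum (u := Finset.univ) (fun j _ => hE j)
  have hq := (hE i).div hZ (by simpa using (smax_den_pos x c b y).ne')
  have : HasLineDerivAt ℝ (smax x c b i) _ y v := hq
  rw [this.lineDeriv]
  simp only [zero_smul, add_zero]
  have hZ0 := (smax_den_pos x c b y).ne'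
  set Z := ∑ j, Real.exp (b * (inner ℝ (x j) y - c j)) with hZdef
  have e1 : ∑ j, smax x c b j y * inner ℝ (x j) v =
      (∑ j, Real.exp (b * (inner ℝ (x j) y - c j)) * inner ℝ (x j) v) / Z := by
    rw [Finset.sum_div]
    refine Finset.sum_congr rfl fun j _ => ?_
    simp only [smax, ← hZdef]; ring
  have e2 : ∑ j, b * inner ℝ (x j) v * Real.exp (b * (inner ℝ (x j) y - c j)) =
      b * ∑ j, Real.exp (b * (inner ℝ (x j) y - c j)) * inner ℝ (x j) v := by
    rw [Finset.mul_sum]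
    exact Finset.sum_congr rfl fun j _ => by ring
  rw [e1, e2]
  simp only [smax, ← hZdef]
  field_simp

/-- the divergence of the smoothed field is nonnegative -/
lemma smax_div_nonneg [Nonempty ι] (x : ι → EuclideanSpace ℝ (Fin d)) (c : ι → ℝ) (b : ℝ)
    (hb : 0 ≤ b) (p : ι → EuclideanSpace ℝ (Fin d))
    (hp : ∀ i j, 0 ≤ (inner ℝ (x i - x j) (p i - p j) : ℝ)) (y : EuclideanSpace ℝ (Fin d)) :
    0 ≤ ∑ i, lineDeriv ℝ (smax x c b i) y (p i) := by
  simp_rw [smax_lineDeriv]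
  set w := fun i => smax x c b i y with hw
  have hw0 : ∀ i, 0 ≤ w i := fun i => smax_nonneg _ _ _ _ _
  have hw1 : ∑ i, w i = 1 := smax_sum x c b y
  have h1 : 0 ≤ ∑ i, ∑ j, w i * w j * inner ℝ (x i - x j) (p i - p j) :=
    Finset.sum_nonneg fun i _ => Finset.sum_nonneg fun j _ =>
      mul_nonneg (mul_nonneg (hw0 i) (hw0 j)) (hp i j)
  have hT : ∀ f : ι → ι → ℝ, ∑ i, ∑ j, f i j = ∑ i, ∑ j, f j i := fun f => Finset.sum_comm
  have h2 : ∑ i, ∑ j, w i * w j * inner ℝ (x i - x j) (p i - p j) =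
      2 * ∑ i, w i * (inner ℝ (x i) (p i) - ∑ j, w j * inner ℝ (x j) (p i)) := by
    have e1 : ∀ i j, w i * w j * (inner ℝ (x i - x j) (p i - p j) : ℝ) =
        (w j * (w i * inner ℝ (x i) (p i)) - w i * (w j * inner ℝ (x j) (p i))) +
        (w i * (w j * inner ℝ (x j) (p j)) - w j * (w i * inner ℝ (x i) (p j))) := by
      intro i j
      simp only [inner_sub_left, inner_sub_right]; ring
    simp_rw [e1, Finset.sum_add_distrib]
    rw [hT (fun i j => w i * (w j * inner ℝ (x j) (p j)) - w j * (w i * inner ℝ (x i) (p j))),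
      ← two_mul]
    congr 1
    refine Finset.sum_congr rfl fun i _ => ?_
    rw [Finset.sum_sub_distrib, ← Finset.sum_mul, hw1, ← Finset.mul_sum]
    ring
  have h3 : ∑ i, b * w i * (inner ℝ (x i) (p i) - ∑ j, w j * inner ℝ (x j) (p i)) =
      b * ∑ i, w i * (inner ℝ (x i) (p i) - ∑ j, w j * inner ℝ (x j) (p i)) := by
    rw [Finset.mul_sum]; exact Finset.sum_congr rfl fun i _ => by ring
  rw [h3]
  exact mul_nonneg hb (by linarith)

/-- radial weight -/
noncomputable def radg (y : EuclideanSpace ℝ (Fin d)) : ℝ := (1 - (min 1 ‖y‖) ^ 2) / 2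

lemma radg_lip : LipschitzWith 1 (radg (d := d)) := by
  apply LipschitzWith.of_dist_le_mul
  intro y z
  rw [Real.dist_eq, dist_eq_norm]
  have h1 : |min 1 ‖y‖ - min 1 ‖z‖| ≤ |‖y‖ - ‖z‖| := by
    have := abs_min_sub_min_le_max (1:ℝ) ‖y‖ 1 ‖z‖
    simpa using this
  have h2 := abs_norm_sub_norm_le y z
  have hy0 : 0 ≤ min 1 ‖y‖ := le_min zero_le_one (norm_nonneg _)
  have hz0 : 0 ≤ min 1 ‖z‖ := le_min zero_le_one (norm_nonneg _)
  have hy1 : min 1 ‖y‖ ≤ 1 := min_le_left _ _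
  have hz1 : min 1 ‖z‖ ≤ 1 := min_le_left _ _
  have h3 : radg y - radg z = -((min 1 ‖y‖ - min 1 ‖z‖) * ((min 1 ‖y‖ + min 1 ‖z‖) / 2)) := by
    unfold radg; ring
  rw [h3, abs_neg, abs_mul, abs_of_nonneg (by positivity : 0 ≤ (min 1 ‖y‖ + min 1 ‖z‖) / 2)]
  simp only [NNReal.coe_one, one_mul]
  calc _ ≤ |min 1 ‖y‖ - min 1 ‖z‖| * 1 := by
        apply mul_le_mul_of_nonneg_left _ (abs_nonneg _); linarith
    _ ≤ _ := by linarith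

lemma radg_nonneg (y : EuclideanSpace ℝ (Fin d)) : 0 ≤ radg y := by
  have hy0 : 0 ≤ min 1 ‖y‖ := le_min zero_le_one (norm_nonneg _)
  have hy1 : min 1 ‖y‖ ≤ 1 := min_le_left _ _
  unfold radg; nlinarith

lemma radg_zero (y : EuclideanSpace ℝ (Fin d)) (hy : 1 ≤ ‖y‖) : radg y = 0 := by
  simp [radg, min_eq_left hy]

lemma radg_compact : HasCompactSupport (radg (d := d)) := by
  apply HasCompactSupport.intro (isCompact_closedBall 0 1)
  intro y hy
  apply radg_zero
  simp only [mem_closedBall, dist_zero_right, not_le] at hy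
  exact hy.le

lemma radg_lineDeriv (y v : EuclideanSpace ℝ (Fin d)) (hy : ‖y‖ ≠ 1) :
    lineDeriv ℝ radg y (-v) =
      (closedBall (0 : EuclideanSpace ℝ (Fin d)) 1).indicator (fun y => inner ℝ v y) y := by
  rcases lt_or_gt_of_ne hy with h | h
  · rw [indicator_of_mem (by simpa using h.le)]
    have hev : radg =ᶠ[nhds y] fun z => (1 - ‖z‖ ^ 2) / 2 := by
      have : {z : EuclideanSpace ℝ (Fin d) | ‖z‖ < 1} ∈ nhds y :=
        (isOpen_lt continuous_norm continuous_const).mem_nhds h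
      filter_upwards [this] with z hz
      have hz' : ‖z‖ < 1 := hz
      simp [radg, min_eq_right hz'.le]
    rw [hev.lineDeriv_eq]
    have hd : HasDerivAt (fun t : ℝ => (1 - ‖y + t • (-v)‖ ^ 2) / 2) (inner ℝ v y) 0 := by
      have h0 : (fun t : ℝ => (1 - ‖y + t • (-v)‖ ^ 2) / 2) =
          fun t : ℝ => (1 - ‖y‖ ^ 2) / 2 + t * inner ℝ v y - t ^ 2 * (‖v‖ ^ 2 / 2) := by
        ext t
        rw [norm_add_sq_real, inner_smul_right, inner_neg_right, norm_smul, norm_neg, mul_pow,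
          real_inner_comm]
        simp; ring
      rw [h0]
      have := (((hasDerivAt_id (0:ℝ)).mul_const (inner ℝ v y)).const_add
        ((1 - ‖y‖ ^ 2) / 2)).fun_sub (((hasDerivAt_id (0:ℝ)).fun_pow 2).mul_const (‖v‖ ^ 2 / 2))
      simpa using this
    have : HasLineDerivAt ℝ (fun z => (1 - ‖z‖ ^ 2) / 2) (inner ℝ v y) y (-v) := hd
    exact this.lineDeriv
  · rw [indicator_of_notMem (by simpa using h)]
    have hev : radg =ᶠ[nhds y] fun z => (0:ℝ) := by
      have : {z : EuclideanSpace ℝ (Fin d) | 1 < ‖z‖} ∈ nhds y :=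
        (isOpen_lt continuous_const continuous_norm).mem_nhds h
      filter_upwards [this] with z hz
      have hz' : 1 < ‖z‖ := hz
      exact radg_zero z hz'.le
    rw [hev.lineDeriv_eq]
    simp [lineDeriv]

lemma smax_ibp [Nonempty ι] (x : ι → EuclideanSpace ℝ (Fin d)) (c : ι → ℝ) (b : ℝ) (i : ι)
    (v : EuclideanSpace ℝ (Fin d)) :
    Integrable (fun y => lineDeriv ℝ (smax x c b i) y v * radg y) ∧
    ∫ y, lineDeriv ℝ (smax x c b i) y v * radg y =
      ∫ y in closedBall (0 : EuclideanSpace ℝ (Fin d)) 1, smax x c b i y * inner ℝ v y := by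
  let χ : ContDiffBump (0 : EuclideanSpace ℝ (Fin d)) := ⟨2, 3, by norm_num, by norm_num⟩
  set f : EuclideanSpace ℝ (Fin d) → ℝ := fun y => χ y * smax x c b i y with hf
  have hfs : ContDiff ℝ 1 f := χ.contDiff.mul (smax_contDiff x c b i)
  have hfc : HasCompactSupport f := χ.hasCompactSupport.mul_right
  obtain ⟨C, hC⟩ := ContDiff.lipschitzWith_of_hasCompactSupport hfc hfs (by simp)
  have hχ : ∀ y : EuclideanSpace ℝ (Fin d), ‖y‖ ≤ 2 → χ y = 1 := fun y hy =>
    χ.one_of_mem_closedBall (by simpa [χ] using hy)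
  have hline : ∀ y, lineDeriv ℝ f y v * radg y = lineDeriv ℝ (smax x c b i) y v * radg y := by
    intro y
    by_cases hy : 1 ≤ ‖y‖
    · rw [radg_zero y hy]; simp
    · have hev : f =ᶠ[nhds y] smax x c b i := by
        have : {z : EuclideanSpace ℝ (Fin d) | ‖z‖ < 2} ∈ nhds y :=
          (isOpen_lt continuous_norm continuous_const).mem_nhds (by
            show ‖y‖ < 2
            linarith)
        filter_upwards [this] with z hz
        have hz' : ‖z‖ < 2 := hz
        simp [hf, hχ z hz'.le]
      rw [hev.lineDeriv_eq]
  have key := LipschitzWith.integral_lineDeriv_mul_eq (μ := volume) hC radg_lip radg_compact v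
  simp_rw [hline] at key
  constructor
  · have hcont : Continuous fun y => lineDeriv ℝ (smax x c b i) y v := by
      simp_rw [smax_lineDeriv]
      have := fun j => (smax_contDiff x c b j).continuous
      fun_prop
    exact (hcont.mul radg_lip.continuous).integrable_of_hasCompactSupport radg_compact.mul_left
  rw [key, ← integral_indicator measurableSet_closedBall]
  apply integral_congr_ae
  have hs : ∀ᵐ y : EuclideanSpace ℝ (Fin d), ‖y‖ ≠ 1 := by
    rw [ae_iff]
    have := Measure.addHaar_sphere_of_ne_zero (volume : Measure (EuclideanSpace ℝ (Fin d)))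
      0 (one_ne_zero)
    refine measure_mono_null ?_ this
    intro y hy
    simpa using hy
  filter_upwards [hs] with y hy
  rw [radg_lineDeriv y v hy]
  by_cases hb : y ∈ closedBall (0 : EuclideanSpace ℝ (Fin d)) 1
  · rw [indicator_of_mem hb, indicator_of_mem hb]
    have : ‖y‖ ≤ 1 := by simpa using hb
    simp only [hf]
    rw [hχ y (by linarith)]; ring
  · rw [indicator_of_notMem hb, indicator_of_notMem hb]; simp

lemma smax_pos [Nonempty ι] (x : ι → EuclideanSpace ℝ (Fin d)) (c : ι → ℝ) (b : ℝ)
    (hb : 0 ≤ b) (p : ι → EuclideanSpace ℝ (Fin d))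
    (hp : ∀ i j, 0 ≤ (inner ℝ (x i - x j) (p i - p j) : ℝ)) :
    0 ≤ ∑ i, ∫ y in closedBall (0 : EuclideanSpace ℝ (Fin d)) 1,
      smax x c b i y * inner ℝ (p i) y := by
  simp_rw [← fun i => (smax_ibp x c b i (p i)).2]
  rw [← integral_finsetSum _ (fun i _ => (smax_ibp x c b i (p i)).1)]
  apply integral_nonneg
  intro y
  simp only [Pi.zero_apply, ← Finset.sum_mul]
  exact mul_nonneg (smax_div_nonneg x c b hb p hp y) (radg_nonneg y)

lemma smax_tendsto [Nonempty ι] (x : ι → EuclideanSpace ℝ (Fin d)) (c : ι → ℝ) (i : ι)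
    (y : EuclideanSpace ℝ (Fin d)) (hy : ‖y‖ ≤ 1)
    (hne : ∀ i j, i ≠ j → inner ℝ (x i) y - c i ≠ inner ℝ (x j) y - c j) :
    Tendsto (fun n : ℕ => smax x c n i y) atTop
      (nhds ((lcell x c i).indicator (fun _ => (1:ℝ)) y)) := by
  classical
  -- lower order terms vanish
  have hlt : ∀ k l, inner ℝ (x l) y - c l < inner ℝ (x k) y - c k →
      Tendsto (fun n : ℕ => smax x c n l y) atTop (nhds 0) := by
    intro k l hkl
    set δ := (inner ℝ (x l) y - c l) - (inner ℝ (x k) y - c k) with hδ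
    have hδ0 : δ < 0 := by rw [hδ]; linarith
    have hexp : Tendsto (fun n : ℕ => (Real.exp δ) ^ n) atTop (nhds 0) :=
      tendsto_pow_atTop_nhds_zero_of_lt_one (Real.exp_pos _).le (by simpa using hδ0)
    refine squeeze_zero (fun n => smax_nonneg _ _ _ _ _) (fun n => ?_) hexp
    unfold smax
    rw [div_le_iff₀ (smax_den_pos x c n y)]
    have h1 : Real.exp (n * (inner ℝ (x k) y - c k)) ≤
        ∑ j, Real.exp (n * (inner ℝ (x j) y - c j)) :=
      Finset.single_le_sum (f := fun j => Real.exp (n * (inner ℝ (x j) y - c j)))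
        (fun _ _ => (Real.exp_pos _).le) (Finset.mem_univ k)
    refine le_trans ?_ (mul_le_mul_of_nonneg_left h1 (by positivity))
    rw [← Real.exp_nat_mul, ← Real.exp_add]
    apply Real.exp_le_exp.mpr
    rw [hδ]; apply le_of_eq; ring
  by_cases hi : y ∈ lcell x c i
  · rw [indicator_of_mem hi]
    have : ∀ n : ℕ, smax x c n i y = 1 - ∑ j ∈ Finset.univ.erase i, smax x c n j y := by
      intro n
      rw [← smax_sum x c n y, ← Finset.add_sum_erase _ _ (Finset.mem_univ i)]; ring
    simp_rw [this]
    have h0 : Tendsto (fun n : ℕ => ∑ j ∈ Finset.univ.erase i, smax x c n j y) atTop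
        (nhds (∑ j ∈ Finset.univ.erase i, (0:ℝ))) := by
      apply tendsto_finsetSum
      intro j hj
      have hji : j ≠ i := Finset.ne_of_mem_erase hj
      exact hlt i j (lt_of_le_of_ne (hi.2 j) (hne j i hji))
    simpa using h0.const_sub 1
  · rw [indicator_of_notMem hi]
    have : ∃ k, inner ℝ (x i) y - c i < inner ℝ (x k) y - c k := by
      by_contra! hcon
      exact hi ⟨hy, hcon⟩
    obtain ⟨k, hk⟩ := this
    exact hlt k i hk

theorem lcell_pos [Nonempty ι] (x : ι → EuclideanSpace ℝ (Fin d))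
    (hx : Function.Injective x) (c : ι → ℝ) (p : ι → EuclideanSpace ℝ (Fin d))
    (hp : ∀ i j, 0 ≤ (inner ℝ (x i - x j) (p i - p j) : ℝ)) :
    0 ≤ ∑ i, ∫ y in lcell x c i, (inner ℝ (p i) y : ℝ) := by
  have hlim : Tendsto (fun n : ℕ => ∑ i, ∫ y in closedBall (0 : EuclideanSpace ℝ (Fin d)) 1,
      smax x c n i y * inner ℝ (p i) y) atTop
      (nhds (∑ i, ∫ y in lcell x c i, (inner ℝ (p i) y : ℝ))) := by
    apply tendsto_finsetSum
    intro i _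
    have e : ∫ y in lcell x c i, (inner ℝ (p i) y : ℝ) =
        ∫ y in closedBall (0 : EuclideanSpace ℝ (Fin d)) 1,
          (lcell x c i).indicator (fun _ => (1:ℝ)) y * inner ℝ (p i) y := by
      have : ∀ y, (lcell x c i).indicator (fun _ => (1:ℝ)) y * inner ℝ (p i) y =
          (lcell x c i).indicator (fun y => (inner ℝ (p i) y : ℝ)) y := by
        intro y
        by_cases h : y ∈ lcell x c i <;> simp [h]
      simp_rw [this]
      rw [setIntegral_indicator (lcell_isClosed x c i).measurableSet,
        inter_eq_self_of_subset_right (lcell_subset x c i)]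
    rw [e]
    apply tendsto_integral_of_dominated_convergence (fun _ => ‖p i‖)
    · intro n
      have := (smax_contDiff x c n i).continuous
      exact (by fun_prop : Continuous fun y => smax x c n i y * inner ℝ (p i) y).aestronglyMeasurable
    · exact const_intOn _
    · intro n
      rw [ae_restrict_iff' measurableSet_closedBall]
      refine Eventually.of_forall fun y hy => ?_
      have hy1 : ‖y‖ ≤ 1 := by simpa using hy
      rw [norm_mul, Real.norm_of_nonneg (smax_nonneg _ _ _ _ _)]
      calc _ ≤ 1 * ‖(inner ℝ (p i) y : ℝ)‖ :=
            mul_le_mul_of_nonneg_right (smax_le_one _ _ _ _ _) (norm_nonneg _)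
        _ ≤ ‖p i‖ * ‖y‖ := by rw [one_mul]; exact norm_inner_le_norm _ _
        _ ≤ _ := mul_le_of_le_one_right (norm_nonneg _) hy1
    · rw [ae_restrict_iff' measurableSet_closedBall]
      filter_upwards [ties_ae x hx c] with y hy hyb
      exact (smax_tendsto x c i y (by simpa using hyb) hy).mul_const _
  exact ge_of_tendsto' hlim fun n => smax_pos x c n (Nat.cast_nonneg n) p hp

end Positivity

section Main3

variable {d : ℕ} {ι : Type*} [Fintype ι]

lemma box_volume (a b : Fin d → ℝ) (hab : ∀ k, a k ≤ b k) (S : Set (EuclideanSpace ℝ (Fin d)))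
    (hS : ∀ y ∈ S, ∀ k, a k ≤ y k ∧ y k ≤ b k) : volume.real S ≤ ∏ k, (b k - a k) := by
  have hsub : S ⊆ (@WithLp.ofLp 2 (Fin d → ℝ)) ⁻¹' (Icc a b) := by
    intro y hy
    exact ⟨fun k => (hS y hy k).1, fun k => (hS y hy k).2⟩
  have hvol : volume ((@WithLp.ofLp 2 (Fin d → ℝ)) ⁻¹' (Icc a b)) =
      ∏ k, ENNReal.ofReal (b k - a k) := by
    rw [(PiLp.volume_preserving_ofLp (Fin d)).measure_preimage
      measurableSet_Icc.nullMeasurableSet, Real.volume_Icc_pi]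
  have h1 := measure_mono (μ := volume) hsub
  rw [hvol, ← ENNReal.ofReal_prod_of_nonneg (fun k _ => sub_nonneg.mpr (hab k))] at h1
  exact ENNReal.toReal_le_of_le_ofReal
    (Finset.prod_nonneg fun k _ => sub_nonneg.mpr (hab k)) h1

lemma lpot_cont [Nonempty ι] (x : ι → EuclideanSpace ℝ (Fin d)) (c : ι → ℝ) :
    Continuous (fun y => lpot x c y) := by
  unfold lpot
  apply Continuous.finset_sup'_apply
  intro i _
  fun_prop

theorem transport_main [Nonempty ι] (x : ι → EuclideanSpace ℝ (Fin d))
    (hx : Function.Injective x) (m : ι → ℝ) (hpos : ∀ i, 0 < m i)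
    (hm : ∑ i, m i = volume.real (closedBall (0 : EuclideanSpace ℝ (Fin d)) 1))
    (p : ι → EuclideanSpace ℝ (Fin d))
    (hp : ∀ i j, 0 ≤ (inner ℝ (x i - x j) (p i - p j) : ℝ)) :
    ∃ (φ : EuclideanSpace ℝ (Fin d) → ℝ)
      (b : EuclideanSpace ℝ (Fin d) → EuclideanSpace ℝ (Fin d)),
      (∀ z, ‖b z‖ ≤ 1) ∧ (∀ z z', φ z + inner ℝ (b z) (z' - z) ≤ φ z') ∧
      0 ≤ ∑ i, m i * inner ℝ (p i) (b (x i)) ∧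
      ∀ i (h : ℝ), 0 < h → m i ≤ ∏ k, ((φ (x i + h • EuclideanSpace.single k 1) +
        φ (x i - h • EuclideanSpace.single k 1) - 2 * φ (x i)) / h) := by
  classical
  have hexc := transport_exists x hx m hpos hm
  obtain ⟨c, hc⟩ := hexc
  have hcontpot : Continuous (fun y => lpot x c y) := lpot_cont x c
  have hmax : ∀ z : EuclideanSpace ℝ (Fin d), ∃ y ∈ closedBall (0 : EuclideanSpace ℝ (Fin d)) 1,
      ∀ y' ∈ closedBall (0 : EuclideanSpace ℝ (Fin d)) 1,
        inner ℝ z y' - lpot x c y' ≤ inner ℝ z y - lpot x c y := by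
    intro z
    obtain ⟨y, hy, hmx⟩ := (isCompact_closedBall (0 : EuclideanSpace ℝ (Fin d)) 1).exists_isMaxOn
      ⟨0, by simp⟩ (f := fun y => inner ℝ z y - lpot x c y)
      (by fun_prop : Continuous fun y => (inner ℝ z y : ℝ) - lpot x c y).continuousOn
    exact ⟨y, hy, fun y' hy' => hmx hy'⟩
  choose Y hYb hYm using hmax
  set φ : EuclideanSpace ℝ (Fin d) → ℝ := fun z => inner ℝ z (Y z) - lpot x c (Y z) with hφ
  have hsubY : ∀ z z' y, y ∈ closedBall (0 : EuclideanSpace ℝ (Fin d)) 1 →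
      φ z ≤ inner ℝ z y - lpot x c y → φ z + inner ℝ y (z' - z) ≤ φ z' := by
    intro z z' y hy h
    have h1 := hYm z' y hy
    have h2 : (inner ℝ y (z' - z) : ℝ) = inner ℝ z' y - inner ℝ z y := by
      rw [inner_sub_right, real_inner_comm, real_inner_comm y z]
    rw [h2]
    show _ ≤ inner ℝ z' (Y z') - lpot x c (Y z')
    linarith
  have hcellsub : ∀ i y z', y ∈ lcell x c i → φ (x i) + inner ℝ y (z' - x i) ≤ φ z' := by
    intro i y z' hy
    apply hsubY _ _ _ (lcell_subset x c i hy)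
    have h1 : lpot x c y ≤ inner ℝ (x i) y - c i := lpot_le _ _ _ _ hy.2
    have h2 := lpot_ge x c (Y (x i)) i
    show inner ℝ (x i) (Y (x i)) - lpot x c (Y (x i)) ≤ _
    linarith
  have hvol0 : ∀ i, volume (lcell x c i) ≠ 0 := by
    intro i h
    have := hc i
    rw [Measure.real, h] at this
    simp at this
    linarith [hpos i]
  have hintg : ∀ i, IntegrableOn (fun y : EuclideanSpace ℝ (Fin d) => y) (lcell x c i) := fun i =>
    (continuous_id.continuousOn.integrableOn_compact (isCompact_closedBall 0 1)).mono_set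
      (lcell_subset x c i)
  set av : ι → EuclideanSpace ℝ (Fin d) := fun i => ⨍ y in lcell x c i, y with hav
  have havmem : ∀ i, av i ∈ lcell x c i := fun i =>
    (lcell_convex x c i).set_average_mem (lcell_isClosed x c i) (hvol0 i) (lcell_finite x c i)
      ((ae_restrict_iff' (lcell_isClosed x c i).measurableSet).2
        (Eventually.of_forall fun y hy => hy)) (hintg i)
  set b : EuclideanSpace ℝ (Fin d) → EuclideanSpace ℝ (Fin d) := fun z =>
    if h : ∃ i, x i = z then av h.choose else Y z with hb
  have hbx : ∀ i, b (x i) = av i := by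
    intro i
    have h : ∃ j, x j = x i := ⟨i, rfl⟩
    simp only [hb, dif_pos h]
    rw [hx h.choose_spec]
  refine ⟨φ, b, fun z => ?_, fun z z' => ?_, ?_, fun i h hh => ?_⟩
  · by_cases h : ∃ i, x i = z
    · obtain ⟨i, rfl⟩ := h
      rw [hbx]; exact (havmem i).1
    · simp only [hb, dif_neg h]; simpa using hYb z
  · by_cases h : ∃ i, x i = z
    · obtain ⟨i, rfl⟩ := h
      rw [hbx]; exact hcellsub i _ z' (havmem i)
    · simp only [hb, dif_neg h]
      exact hsubY z z' (Y z) (hYb z) le_rfl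
  · have := lcell_pos x hx c p hp
    convert this using 2 with i _
    rw [hbx, hav, integral_inner (hintg i)]
    simp only [setAverage_eq]
    rw [inner_smul_right, hc i, ← mul_assoc, mul_inv_cancel₀ (hpos i).ne', one_mul]
  · rw [← hc i]
    set xi := x i
    have hcoord : ∀ (y : EuclideanSpace ℝ (Fin d)) k,
        (inner ℝ y (h • EuclideanSpace.single k (1:ℝ)) : ℝ) = h * y k := by
      intro y k
      rw [inner_smul_right, EuclideanSpace.inner_single_right]; simp
    have hin : ∀ y ∈ lcell x c i, ∀ k, (φ xi - φ (xi - h • EuclideanSpace.single k 1)) / h ≤ y k ∧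
        y k ≤ (φ (xi + h • EuclideanSpace.single k 1) - φ xi) / h := by
      intro y hy k
      have h1 := hcellsub i y (xi + h • EuclideanSpace.single k 1) hy
      have h2 := hcellsub i y (xi - h • EuclideanSpace.single k 1) hy
      rw [show xi + h • EuclideanSpace.single k (1:ℝ) - x i = h • EuclideanSpace.single k 1 by
        simp [xi], hcoord] at h1
      rw [show xi - h • EuclideanSpace.single k (1:ℝ) - x i = -(h • EuclideanSpace.single k 1) by
        simp [xi], inner_neg_right, hcoord] at h2
      constructor
      · rw [div_le_iff₀ hh]; linarith
      · rw [le_div_iff₀ hh]; linarith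
    refine (box_volume _ _ (fun k => ?_) _ hin).trans (le_of_eq ?_)
    · exact (hin _ (havmem i) k).1.trans (hin _ (havmem i) k).2
    · refine Finset.prod_congr rfl fun k _ => ?_
      ring

end Main3

section Lattice

variable {d : ℕ}

/-- Lattice points. -/
noncomputable def latP (h : ℝ) (z : Fin d → ℤ) : EuclideanSpace ℝ (Fin d) :=
  WithLp.toLp 2 (fun k => h * (z k : ℝ))

lemma latP_add (h : ℝ) (z : Fin d → ℤ) (k : Fin d) :
    latP h (z + Pi.single k 1) = latP h z + h • EuclideanSpace.single k (1:ℝ) := by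
  ext j
  by_cases hj : j = k
  · subst hj; simp [latP, mul_add]
  · simp [latP, hj]

lemma latP_sub (h : ℝ) (z : Fin d → ℤ) (k : Fin d) :
    latP h (z - Pi.single k 1) = latP h z - h • EuclideanSpace.single k (1:ℝ) := by
  rw [eq_sub_iff_add_eq, ← latP_add]; simp

lemma latP_inj (h : ℝ) (hh : 0 < h) : Function.Injective (latP (d := d) h) := by
  intro z z' hz
  ext k
  have := congrArg (fun y : EuclideanSpace ℝ (Fin d) => y k) hz
  simp only [latP] at this
  have h2 := mul_left_cancel₀ hh.ne' this
  exact_mod_cast h2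

/-- box of lattice indices -/
noncomputable def latBox (d : ℕ) (h ρ : ℝ) : Finset (Fin d → ℤ) :=
  Fintype.piFinset (fun _ => Finset.Icc (-(⌊ρ / h⌋₊ : ℤ)) (⌊ρ / h⌋₊ : ℤ))

lemma mem_latBox (h ρ : ℝ) (hh : 0 < h) (z : Fin d → ℤ) (hz : ‖latP h z‖ ≤ ρ) :
    z ∈ latBox d h ρ := by
  rw [latBox, Fintype.mem_piFinset]
  intro k
  have h1 : ‖(latP h z) k‖ ≤ ρ := (PiLp.norm_apply_le _ k).trans hz
  have h2 : h * |(z k : ℝ)| ≤ ρ := by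
    simpa [latP, abs_mul, abs_of_pos hh] using h1
  have h3 : ((z k).natAbs : ℝ) ≤ ρ / h := by
    rw [le_div_iff₀ hh, Nat.cast_natAbs]; push_cast; linarith
  have h4 : (z k).natAbs ≤ ⌊ρ / h⌋₊ := Nat.le_floor h3
  rw [Finset.mem_Icc]; omega

lemma latBox_card (h ρ : ℝ) (hh : 0 < h) (hh1 : h ≤ 1) (hρ : 0 ≤ ρ) :
    h ^ d * ((latBox d h ρ).card : ℝ) ≤ (2 * ρ + 1) ^ d := by
  have h0 : ((latBox d h ρ).card : ℝ) = (2 * (⌊ρ / h⌋₊ : ℝ) + 1) ^ d := by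
    rw [latBox, Fintype.card_piFinset]
    simp only [Int.card_Icc, Finset.prod_const, Finset.card_univ, Fintype.card_fin]
    rw [show ((⌊ρ / h⌋₊ : ℤ) + 1 - -(⌊ρ / h⌋₊ : ℤ)).toNat = 2 * ⌊ρ / h⌋₊ + 1 by omega]
    push_cast; ring
  rw [h0, ← mul_pow]
  apply pow_le_pow_left₀ (by positivity)
  have h1 : (⌊ρ / h⌋₊ : ℝ) ≤ ρ / h := Nat.floor_le (by positivity)
  rw [le_div_iff₀ hh] at h1
  linarith

lemma lat_summable (h ρ : ℝ) (hh : 0 < h) (f : (Fin d → ℤ) → ℝ)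
    (hf : ∀ z, ρ < ‖latP h z‖ → f z = 0) : Summable f := by
  apply summable_of_ne_finset_zero (s := latBox d h ρ)
  intro z hz
  apply hf
  by_contra hcon
  exact hz (mem_latBox h ρ hh z (not_lt.mp hcon))

lemma lat_sum_bound (h ρ : ℝ) (hh : 0 < h) (hh1 : h ≤ 1) (hρ : 0 ≤ ρ) (M : ℝ) (hM : 0 ≤ M)
    (f : (Fin d → ℤ) → ℝ) (hf : ∀ z, ρ < ‖latP h z‖ → f z = 0)
    (hfM : ∀ z, ‖latP h z‖ ≤ ρ → f z ≤ M) :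
    h ^ d * ∑' z, f z ≤ M * (2 * ρ + 1) ^ d := by
  have h0 : ∑' z, f z = ∑ z ∈ latBox d h ρ, f z := by
    apply tsum_eq_sum
    intro z hz
    apply hf
    by_contra hcon
    exact hz (mem_latBox h ρ hh z (not_lt.mp hcon))
  have h1 : ∑ z ∈ latBox d h ρ, f z ≤ (latBox d h ρ).card * M := by
    rw [← nsmul_eq_mul]
    apply Finset.sum_le_card_nsmul
    intro z _
    by_cases hz : ‖latP h z‖ ≤ ρ
    · exact hfM z hz
    · rw [hf z (not_le.mp hz)]; exact hM
  rw [h0]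
  calc h ^ d * ∑ z ∈ latBox d h ρ, f z ≤ h ^ d * ((latBox d h ρ).card * M) := by gcongr
    _ = (h ^ d * (latBox d h ρ).card) * M := by ring
    _ ≤ (2 * ρ + 1) ^ d * M := mul_le_mul_of_nonneg_right (latBox_card h ρ hh hh1 hρ) hM
    _ = _ := by ring

lemma lat_ibp (u φ : (Fin d → ℤ) → ℝ) (hu : (Function.support u).Finite) (e : Fin d → ℤ) :
    ∑' z, u z * (φ (z + e) + φ (z - e) - 2 * φ z) =
      ∑' z, -((u (z + e) - u z) * (φ (z + e) - φ z)) := by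
  set F : (Fin d → ℤ) → ℝ := fun z => u z * (φ z - φ (z - e)) with hF
  set H : (Fin d → ℤ) → ℝ := fun z => u z * (φ (z + e) - φ z) with hH
  have hFs : Summable F := summable_of_hasFiniteSupport
    (hu.subset (Function.support_mul_subset_left _ _))
  have hHs : Summable H := summable_of_hasFiniteSupport
    (hu.subset (Function.support_mul_subset_left _ _))
  have hFs' : Summable (fun z => F (z + e)) := (Equiv.addRight e).summable_iff.mpr hFs
  have hsh : ∑' z, F (z + e) = ∑' z, F z := (Equiv.addRight e).tsum_eq F
  have h1 : ∀ z, u z * (φ (z + e) + φ (z - e) - 2 * φ z) = H z - F z := by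
    intro z; simp only [hF, hH]; ring
  have h2 : ∀ z, -((u (z + e) - u z) * (φ (z + e) - φ z)) = H z - F (z + e) := by
    intro z; simp only [hF, hH, add_sub_cancel_right]; ring
  simp_rw [h1, h2]
  rw [hHs.tsum_sub hFs, hHs.tsum_sub hFs', hsh]

lemma lat_telescope (h ρ L : ℝ) (hh : 0 < h) (hh1 : h ≤ 1) (hρ : 0 ≤ ρ) (hL : 0 ≤ L)
    (q : EuclideanSpace ℝ (Fin d) → EuclideanSpace ℝ (Fin d)) (k : Fin d)
    (hmon : ∀ z, (q (latP h z)) k ≤ (q (latP h (z + Pi.single k 1))) k)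
    (hq : ∀ x, ‖x‖ ≤ ρ + 3 → ‖q x‖ ≤ L) :
    h ^ d * ∑' z : Fin d → ℤ, (if ‖latP h z‖ ≤ ρ then
      (q (latP h (z + Pi.single k 1))) k - (q (latP h z)) k else 0) ≤
      h * L * (2 * (ρ + 3) + 1) ^ d := by
  set χ : EuclideanSpace ℝ (Fin d) → ℝ := fun x => max 0 (min 1 (ρ + 1 - ‖x‖)) with hχ
  have hχ0 : ∀ x, 0 ≤ χ x := fun x => le_max_left _ _
  have hχ1 : ∀ x, ‖x‖ ≤ ρ → χ x = 1 := by
    intro x hx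
    simp only [hχ]
    rw [min_eq_left (by linarith), max_eq_right zero_le_one]
  have hχz : ∀ x, ρ + 1 < ‖x‖ → χ x = 0 := by
    intro x hx
    simp only [hχ]
    apply max_eq_left
    exact (min_le_right _ _).trans (by linarith)
  have hχl : ∀ x y, |χ x - χ y| ≤ ‖x - y‖ := by
    intro x y
    simp only [hχ]
    have h1 : |max 0 (min 1 (ρ + 1 - ‖x‖)) - max 0 (min 1 (ρ + 1 - ‖y‖))| ≤
        |min 1 (ρ + 1 - ‖x‖) - min 1 (ρ + 1 - ‖y‖)| := by
      simpa using abs_max_sub_max_le_max (0:ℝ) (min 1 (ρ + 1 - ‖x‖)) 0 (min 1 (ρ + 1 - ‖y‖))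
    have h2 : |min 1 (ρ + 1 - ‖x‖) - min 1 (ρ + 1 - ‖y‖)| ≤
        |(ρ + 1 - ‖x‖) - (ρ + 1 - ‖y‖)| := by
      simpa using abs_min_sub_min_le_max (1:ℝ) (ρ + 1 - ‖x‖) 1 (ρ + 1 - ‖y‖)
    have h3 := abs_norm_sub_norm_le x y
    have h4 : ρ + 1 - ‖x‖ - (ρ + 1 - ‖y‖) = -(‖x‖ - ‖y‖) := by ring
    rw [h4, abs_neg] at h2
    exact h1.trans (h2.trans h3)
  set e : Fin d → ℤ := Pi.single k 1 with he
  have hne : ‖(h • EuclideanSpace.single k (1:ℝ) : EuclideanSpace ℝ (Fin d))‖ = h := by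
    rw [norm_smul]; simp [abs_of_pos hh]
  have hnorm : ∀ z : Fin d → ℤ, ‖latP h (z - e)‖ ≥ ‖latP h z‖ - h := by
    intro z
    rw [latP_sub]
    have := norm_sub_norm_le (latP h z) (h • EuclideanSpace.single k (1:ℝ))
    rw [hne] at this; linarith
  set Q : (Fin d → ℤ) → ℝ := fun z => (q (latP h z)) k with hQ
  set F : (Fin d → ℤ) → ℝ := fun z => χ (latP h (z - e)) * Q z with hF
  set H : (Fin d → ℤ) → ℝ := fun z => χ (latP h z) * Q z with hH
  have hFz : ∀ z, ρ + 3 < ‖latP h z‖ → F z = 0 := by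
    intro z hz
    simp only [hF]
    rw [hχz _ (by linarith [hnorm z]), zero_mul]
  have hHz : ∀ z, ρ + 3 < ‖latP h z‖ → H z = 0 := by
    intro z hz
    simp only [hH]
    rw [hχz _ (by linarith), zero_mul]
  have hFs : Summable F := lat_summable h (ρ + 3) hh F hFz
  have hHs : Summable H := lat_summable h (ρ + 3) hh H hHz
  have hFs' : Summable (fun z => F (z + e)) := (Equiv.addRight e).summable_iff.mpr hFs
  have hsh : ∑' z, F (z + e) = ∑' z, F z := (Equiv.addRight e).tsum_eq F
  have hle : ∑' z : Fin d → ℤ, (if ‖latP h z‖ ≤ ρ then Q (z + e) - Q z else 0) ≤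
      ∑' z, (F (z + e) - H z) := by
    apply Summable.tsum_le_tsum
    · intro z
      have : F (z + e) - H z = χ (latP h z) * (Q (z + e) - Q z) := by
        simp only [hF, hH, add_sub_cancel_right]; ring
      rw [this]
      split_ifs with hz
      · rw [hχ1 _ hz, one_mul]
      · exact mul_nonneg (hχ0 _) (sub_nonneg.mpr (hmon z))
    · apply lat_summable h ρ hh
      intro z hz
      rw [if_neg (not_le.mpr hz)]
    · exact hFs'.sub hHs
  rw [hFs'.tsum_sub hHs, hsh, ← hFs.tsum_sub hHs] at hle
  have hb := lat_sum_bound h (ρ + 3) hh hh1 (by linarith) (h * L) (by positivity)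
    (fun z => F z - H z) (fun z hz => by rw [hFz z hz, hHz z hz, sub_zero]) (by
      intro z hz
      have h1 : F z - H z = (χ (latP h (z - e)) - χ (latP h z)) * Q z := by
        simp only [hF, hH]; ring
      rw [h1]
      have h2 : |χ (latP h (z - e)) - χ (latP h z)| ≤ h := by
        refine (hχl _ _).trans ?_
        rw [latP_sub, sub_sub_cancel_left, norm_neg, hne]
      have h3 : |Q z| ≤ L := by
        have : ‖(q (latP h z)) k‖ ≤ ‖q (latP h z)‖ := PiLp.norm_apply_le _ k
        exact (Real.norm_eq_abs _ ▸ this).trans (hq _ hz)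
      calc _ ≤ |(χ (latP h (z - e)) - χ (latP h z)) * Q z| := le_abs_self _
        _ = |χ (latP h (z - e)) - χ (latP h z)| * |Q z| := abs_mul _ _
        _ ≤ h * L := mul_le_mul h2 h3 (abs_nonneg _) hh.le)
  exact (mul_le_mul_of_nonneg_left hle (by positivity)).trans hb

/-- The scalar estimate for the difference quotient of `η e^V`. -/
lemma scalar_est (h L Λ Cη η η' v v' p p' g : ℝ) (hh : 0 < h) (hh1 : h ≤ 1) (hL : 0 ≤ L)
    (hΛ : 0 ≤ Λ) (hv : v ≤ L) (hη0 : 0 ≤ η) (hη1 : η ≤ 1) (hη0' : 0 ≤ η') (hη1' : η' ≤ 1)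
    (hp : |p| ≤ L) (hp' : |p'| ≤ L) (h1 : h * p ≤ v' - v) (h2 : v' - v ≤ h * p')
    (hl : |η' - η| ≤ Λ * h) (hg : |η' - η - h * g| ≤ Cη * h ^ 2) :
    |(η' * Real.exp v' - η * Real.exp v) / h| ≤ Real.exp L * (Λ + L * Real.exp L) ∧
    |(η' * Real.exp v' - η * Real.exp v) / h - Real.exp v * g - η * Real.exp v * p| ≤
      Real.exp L * (p' - p) +
        (Real.exp L * Cη + Λ * L * Real.exp L ^ 2 + L ^ 2 * Real.exp L ^ 2) * h := by
  set s := v' - v with hs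
  set W := Real.exp L with hW
  set w := Real.exp v with hw
  have hw0 : 0 < w := Real.exp_pos _
  have hwW : w ≤ W := Real.exp_le_exp.mpr hv
  have hW0 : 0 < W := Real.exp_pos _
  have hexp : Real.exp v' = w * Real.exp s := by
    rw [hw, ← Real.exp_add, hs]; congr 1; ring
  have hsabs : |s| ≤ h * L := by
    rw [abs_le] at hp hp' ⊢
    constructor
    · nlinarith
    · nlinarith
  have hsL : |s| ≤ L := hsabs.trans (by nlinarith)
  have he1 : |Real.exp s - 1| ≤ |s| * W := by
    have a1 := Real.add_one_le_exp s
    have a2 := Real.add_one_le_exp (-s)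
    have a3 : Real.exp s * Real.exp (-s) = 1 := by rw [← Real.exp_add]; simp
    have a4 : Real.exp s - 1 ≤ s * Real.exp s := by
      nlinarith [Real.exp_pos s]
    have a5 : Real.exp s ≤ W := Real.exp_le_exp.mpr ((le_abs_self s).trans hsL)
    have a6 : 1 ≤ W := Real.one_le_exp hL
    rw [abs_le]
    constructor
    · have : -|s| ≤ s := neg_abs_le s
      nlinarith [abs_nonneg s]
    · calc _ ≤ s * Real.exp s := a4
        _ ≤ |s| * Real.exp s := mul_le_mul_of_nonneg_right (le_abs_self s) (Real.exp_pos s).le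
        _ ≤ |s| * W := mul_le_mul_of_nonneg_left a5 (abs_nonneg s)
  have he1' : |Real.exp s - 1| ≤ h * L * W :=
    he1.trans (mul_le_mul_of_nonneg_right hsabs hW0.le)
  have he2 : |Real.exp s - 1 - s| ≤ (h * L) * (h * L * W) := by
    have a1 := Real.add_one_le_exp s
    have a2 := Real.add_one_le_exp (-s)
    have a3 : Real.exp s * Real.exp (-s) = 1 := by rw [← Real.exp_add]; simp
    have a4 : Real.exp s - 1 ≤ s * Real.exp s := by
      nlinarith [Real.exp_pos s]
    rw [abs_of_nonneg (by linarith)]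
    calc Real.exp s - 1 - s ≤ s * (Real.exp s - 1) := by linarith
      _ ≤ |s * (Real.exp s - 1)| := le_abs_self _
      _ = |s| * |Real.exp s - 1| := abs_mul _ _
      _ ≤ _ := mul_le_mul hsabs he1' (abs_nonneg _) (by positivity)
  have hΛh : 0 ≤ Λ * h := by positivity
  constructor
  · have e1 : (η' * Real.exp v' - η * w) / h = w * ((η' - η) + η' * (Real.exp s - 1)) / h := by
      rw [hexp]; ring
    rw [e1, abs_div, abs_of_pos hh, div_le_iff₀ hh, abs_mul, abs_of_pos hw0]
    have : |(η' - η) + η' * (Real.exp s - 1)| ≤ Λ * h + h * L * W := by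
      refine (abs_add_le _ _).trans (add_le_add hl ?_)
      rw [abs_mul, abs_of_nonneg hη0']
      exact (mul_le_of_le_one_left (abs_nonneg _) hη1').trans he1'
    calc _ ≤ W * (Λ * h + h * L * W) := mul_le_mul hwW this (abs_nonneg _) hW0.le
      _ = _ := by ring
  · have e1 : (η' * Real.exp v' - η * w) / h - w * g - η * w * p =
        (w * ((η' - η - h * g) + (η' - η) * (Real.exp s - 1) + η * (Real.exp s - 1 - s) +
          η * (s - h * p))) / h := by
      rw [hexp]; field_simp; ring
    rw [e1, abs_div, abs_of_pos hh, div_le_iff₀ hh, abs_mul, abs_of_pos hw0]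
    have b1 : |(η' - η) * (Real.exp s - 1)| ≤ Λ * h * (h * L * W) := by
      rw [abs_mul]; exact mul_le_mul hl he1' (abs_nonneg _) hΛh
    have b2 : |η * (Real.exp s - 1 - s)| ≤ (h * L) * (h * L * W) := by
      rw [abs_mul, abs_of_nonneg hη0]
      exact (mul_le_of_le_one_left (abs_nonneg _) hη1).trans he2
    have b3 : |η * (s - h * p)| ≤ h * (p' - p) := by
      rw [abs_mul, abs_of_nonneg hη0, abs_of_nonneg (by linarith)]
      exact (mul_le_of_le_one_left (by linarith) hη1).trans (by linarith)
    have b4 : |(η' - η - h * g) + (η' - η) * (Real.exp s - 1) + η * (Real.exp s - 1 - s) +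
          η * (s - h * p)| ≤ Cη * h ^ 2 + Λ * h * (h * L * W) + (h * L) * (h * L * W)
            + h * (p' - p) := by
      refine (abs_add_le _ _).trans (add_le_add ((abs_add_le _ _).trans
        (add_le_add ((abs_add_le _ _).trans (add_le_add hg b1)) b2)) b3)
    calc _ ≤ W * (Cη * h ^ 2 + Λ * h * (h * L * W) + (h * L) * (h * L * W) + h * (p' - p)) :=
          mul_le_mul hwW b4 (abs_nonneg _) hW0.le
      _ = _ := by ring

/-- Pointwise estimate used after summation by parts. -/
lemma prod_est (Du D b b' t err C1 : ℝ) (hD1 : b ≤ D) (hD2 : D ≤ b') (hb : |b| ≤ 1)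
    (h1 : |Du| ≤ C1) (h2 : |Du - t| ≤ err) :
    -(Du * D) ≤ -(t * b) + (C1 * (b' - b) + err) := by
  have e : -(Du * D) = -(t * b) + (-(Du * (D - b)) + -((Du - t) * b)) := by ring
  have a1 : -(Du * (D - b)) ≤ C1 * (b' - b) := by
    calc _ ≤ |Du * (D - b)| := neg_le_abs _
      _ = |Du| * |D - b| := abs_mul _ _
      _ ≤ C1 * (b' - b) := by
        rw [abs_of_nonneg (by linarith : 0 ≤ D - b)]
        exact mul_le_mul h1 (by linarith) (by linarith) ((abs_nonneg _).trans h1)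
  have a2 : -((Du - t) * b) ≤ err := by
    calc _ ≤ |(Du - t) * b| := neg_le_abs _
      _ = |Du - t| * |b| := abs_mul _ _
      _ ≤ |Du - t| * 1 := mul_le_mul_of_nonneg_left hb (abs_nonneg _)
      _ ≤ err := by linarith
  rw [e]; linarith

end Lattice

section Discrete

variable {d : ℕ}

lemma euclid_inner_sum (x y : EuclideanSpace ℝ (Fin d)) : inner ℝ x y = ∑ k, x k * y k := by
  simp [PiLp.inner_apply, mul_comm]

/-- constants -/
noncomputable def cC1 (L Λ : ℝ) : ℝ := Real.exp L * (Λ + L * Real.exp L)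

/-- constants -/
noncomputable def cC3 (L Λ Cη : ℝ) : ℝ :=
  Real.exp L * Cη + Λ * L * Real.exp L ^ 2 + L ^ 2 * Real.exp L ^ 2

/-- One coordinate, pointwise. -/
lemma disc_coord (h ρ L Λ Cη : ℝ) (hh : 0 < h) (hh1 : h ≤ 1) (hL : 0 ≤ L)
    (hΛ : 0 ≤ Λ) (V η φ : EuclideanSpace ℝ (Fin d) → ℝ)
    (p G b : EuclideanSpace ℝ (Fin d) → EuclideanSpace ℝ (Fin d))
    (hp : ∀ x y, V x + inner ℝ (p x) (y - x) ≤ V y)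
    (hVL : ∀ x, ‖x‖ ≤ ρ + 4 → V x ≤ L) (hpL : ∀ x, ‖x‖ ≤ ρ + 4 → ‖p x‖ ≤ L)
    (hη0 : ∀ x, 0 ≤ η x) (hη1 : ∀ x, η x ≤ 1)
    (hηz : ∀ x, ρ < ‖x‖ → η x = 0) (hGz : ∀ x, ρ < ‖x‖ → G x = 0)
    (hl : ∀ x (k : Fin d), |η (x + h • EuclideanSpace.single k 1) - η x| ≤ Λ * h)
    (hg : ∀ x (k : Fin d), |η (x + h • EuclideanSpace.single k 1) - η x - h * G x k| ≤ Cη * h ^ 2)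
    (hb1 : ∀ z, ‖b z‖ ≤ 1) (hb : ∀ z z', φ z + inner ℝ (b z) (z' - z) ≤ φ z')
    (x : EuclideanSpace ℝ (Fin d)) (k : Fin d) (y : EuclideanSpace ℝ (Fin d))
    (hy : y = x + h • EuclideanSpace.single k 1) :
    -((η y * Real.exp (V y) - η x * Real.exp (V x)) / h * ((φ y - φ x) / h)) ≤
      -((Real.exp (V x) * G x k + η x * Real.exp (V x) * p x k) * b x k) +
      (cC1 L Λ * (if ‖x‖ ≤ ρ + 1 then b y k - b x k else 0) +
        Real.exp L * (if ‖x‖ ≤ ρ + 1 then p y k - p x k else 0) +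
        (if ‖x‖ ≤ ρ + 1 then cC3 L Λ Cη * h else 0)) := by
  have hyx : y - x = h • EuclideanSpace.single k (1:ℝ) := by rw [hy]; abel
  have hne : ‖y - x‖ = h := by rw [hyx, norm_smul]; simp [abs_of_pos hh]
  have hin : ∀ q : EuclideanSpace ℝ (Fin d), inner ℝ q (y - x) = h * q k := by
    intro q; rw [hyx, inner_smul_right, EuclideanSpace.inner_single_right]; simp
  have hin' : ∀ q : EuclideanSpace ℝ (Fin d), inner ℝ q (x - y) = -(h * q k) := by
    intro q; rw [← neg_sub y x, inner_neg_right, hin]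
  by_cases hx : ‖x‖ ≤ ρ + 1
  · simp only [if_pos hx]
    have hyn : ‖y‖ ≤ ρ + 4 := by
      have := norm_sub_norm_le y x
      linarith
    have hpa : ∀ x, ‖x‖ ≤ ρ + 4 → |p x k| ≤ L := fun x hx =>
      (Real.norm_eq_abs _ ▸ PiLp.norm_apply_le (p x) k).trans (hpL x hx)
    have e1 := hp x y
    have e2 := hp y x
    rw [hin] at e1
    rw [hin'] at e2
    have f1 := hb x y
    have f2 := hb y x
    rw [hin] at f1
    rw [hin'] at f2
    obtain ⟨s1, s2⟩ := scalar_est h L Λ Cη (η x) (η y) (V x) (V y) (p x k) (p y k) (G x k) hh hh1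
      hL hΛ (hVL x (by linarith)) (hη0 x) (hη1 x) (hη0 y) (hη1 y) (hpa x (by linarith)) (hpa y hyn)
      (by linarith) (by linarith) (by rw [hy]; exact hl x k) (by rw [hy]; exact hg x k)
    have s2' : |(η y * Real.exp (V y) - η x * Real.exp (V x)) / h -
        (Real.exp (V x) * G x k + η x * Real.exp (V x) * p x k)| ≤ Real.exp L * (p y k - p x k) +
        cC3 L Λ Cη * h := by
      rw [← sub_sub]; exact s2
    have := prod_est _ ((φ y - φ x) / h) (b x k) (b y k) _ _ _
      (by rw [le_div_iff₀ hh]; linarith) (by rw [div_le_iff₀ hh]; linarith)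
      ((Real.norm_eq_abs _ ▸ PiLp.norm_apply_le (b x) k).trans (hb1 x)) s1 s2'
    refine this.trans (le_of_eq ?_)
    simp only [cC1]; ring
  · simp only [if_neg hx]
    have hxρ : ρ < ‖x‖ := by linarith
    have hyρ : ρ < ‖y‖ := by
      have := norm_sub_norm_le x y
      rw [norm_sub_rev, hne] at this
      linarith
    rw [hηz x hxρ, hηz y hyρ, hGz x hxρ]; simp

/-- Pointwise estimate, summed over coordinates. -/
lemma disc_point (ρ L : ℝ) (V η : EuclideanSpace ℝ (Fin d) → ℝ) (A : Set (EuclideanSpace ℝ (Fin d)))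
    (p G b : EuclideanSpace ℝ (Fin d) → EuclideanSpace ℝ (Fin d))
    (hpL : ∀ x, ‖x‖ ≤ ρ + 4 → ‖p x‖ ≤ L)
    (hη0 : ∀ x, 0 ≤ η x) (hηA : ∀ x ∈ A, η x = 1)
    (hηz : ∀ x, ρ < ‖x‖ → η x = 0) 
    (hb1 : ∀ z, ‖b z‖ ≤ 1) (x : EuclideanSpace ℝ (Fin d)) :
    ∑ k, -((Real.exp (V x) * G x k + η x * Real.exp (V x) * p x k) * b x k) ≤
      ‖G x‖ * Real.exp (V x) - A.indicator (fun x => Real.exp (V x) * inner ℝ (p x) (b x)) x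
      + L * (η x * Real.exp (V x) - A.indicator (fun x => Real.exp (V x)) x) := by
  have e : ∑ k, -((Real.exp (V x) * G x k + η x * Real.exp (V x) * p x k) * b x k) =
      Real.exp (V x) * (-inner ℝ (G x) (b x)) + η x * Real.exp (V x) * (-inner ℝ (p x) (b x)) := by
    rw [euclid_inner_sum, euclid_inner_sum, ← Finset.sum_neg_distrib, ← Finset.sum_neg_distrib,
      Finset.mul_sum, Finset.mul_sum, ← Finset.sum_add_distrib]
    exact Finset.sum_congr rfl fun k _ => by ring
  rw [e]
  have hw : 0 < Real.exp (V x) := Real.exp_pos _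
  have h1 : -inner ℝ (G x) (b x) ≤ ‖G x‖ := by
    have := neg_le_of_abs_le (abs_real_inner_le_norm (G x) (b x))
    have h2 : ‖G x‖ * ‖b x‖ ≤ ‖G x‖ := mul_le_of_le_one_right (norm_nonneg _) (hb1 x)
    linarith
  have h1' := mul_le_mul_of_nonneg_left h1 hw.le
  by_cases hA : x ∈ A
  · simp only [indicator_of_mem hA, hηA x hA]
    linarith
  · simp only [indicator_of_notMem hA]
    by_cases hx : ρ < ‖x‖
    · rw [hηz x hx]; linarith
    · have h3 : -inner ℝ (p x) (b x) ≤ L := by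
        have := neg_le_of_abs_le (abs_real_inner_le_norm (p x) (b x))
        have h2 : ‖p x‖ * ‖b x‖ ≤ ‖p x‖ := mul_le_of_le_one_right (norm_nonneg _) (hb1 x)
        have := hpL x (by linarith)
        linarith
      have := mul_le_mul_of_nonneg_left h3 (mul_nonneg (hη0 x) hw.le)
      linarith

lemma amgm_fin (hd : 0 < d) (δ : Fin d → ℝ) (hδ : ∀ k, 0 ≤ δ k) (m : ℝ) (hm : 0 ≤ m)
    (h : m ≤ ∏ k, δ k) : d * m ^ ((1:ℝ) / d) ≤ ∑ k, δ k := by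
  have hd' : (0:ℝ) < d := by exact_mod_cast hd
  have := Real.geom_mean_le_arith_mean Finset.univ (fun _ : Fin d => (1:ℝ)) δ (by simp)
    (by simpa using hd) (fun i _ => hδ i)
  simp only [Real.rpow_one, Finset.sum_const, Finset.card_univ, Fintype.card_fin, nsmul_eq_mul,
    mul_one, one_mul] at this
  rw [le_div_iff₀ hd'] at this
  have h2 : m ^ ((1:ℝ) / d) ≤ (∏ k, δ k) ^ ((d:ℝ)⁻¹) := by
    rw [one_div]; exact Real.rpow_le_rpow hm h (by positivity)
  nlinarith

end Discrete

section DiscreteMain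

variable {d : ℕ}

/-- The final constant. -/
noncomputable def cC (d : ℕ) (ρ L Λ Cη : ℝ) : ℝ :=
  d * (cC1 L Λ * (1 * (2 * (ρ + 1 + 3) + 1) ^ d) + Real.exp L * (L * (2 * (ρ + 1 + 3) + 1) ^ d)
    + cC3 L Λ Cη * (2 * (ρ + 1) + 1) ^ d)

set_option maxHeartbeats 600000 in
lemma discrete_ineq (hd : 2 ≤ d) (h ρ L Λ Cη : ℝ) (hh : 0 < h) (hh1 : h ≤ 1) (hρ : 0 ≤ ρ)
    (hL : 0 ≤ L) (hΛ : 0 ≤ Λ) (hCη : 0 ≤ Cη) (V η : EuclideanSpace ℝ (Fin d) → ℝ)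
    (A : Set (EuclideanSpace ℝ (Fin d)))
    (p G : EuclideanSpace ℝ (Fin d) → EuclideanSpace ℝ (Fin d))
    (hV0 : ∀ x, 0 ≤ V x)
    (hp : ∀ x y, V x + inner ℝ (p x) (y - x) ≤ V y)
    (hVL : ∀ x, ‖x‖ ≤ ρ + 4 → V x ≤ L) (hpL : ∀ x, ‖x‖ ≤ ρ + 4 → ‖p x‖ ≤ L)
    (hη0 : ∀ x, 0 ≤ η x) (hη1 : ∀ x, η x ≤ 1) (hηA : ∀ x ∈ A, η x = 1)
    (hηz : ∀ x, ρ < ‖x‖ → η x = 0) (hGz : ∀ x, ρ < ‖x‖ → G x = 0)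
    (hl : ∀ x (k : Fin d), |η (x + h • EuclideanSpace.single k 1) - η x| ≤ Λ * h)
    (hg : ∀ x (k : Fin d),
      |η (x + h • EuclideanSpace.single k 1) - η x - h * G x k| ≤ Cη * h ^ 2)
    (a : ℝ) (ha : a = h ^ d * ∑' z, A.indicator (fun x => Real.exp (V x)) (latP h z)) :
    d * (volume.real (closedBall (0 : EuclideanSpace ℝ (Fin d)) 1)) ^ ((1:ℝ) / d) *
      a ^ (1 - (1:ℝ) / d) ≤
    h ^ d * (∑' z, ‖G (latP h z)‖ * Real.exp (V (latP h z))) +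
      L * (h ^ d * (∑' z, η (latP h z) * Real.exp (V (latP h z))) - a) + cC d ρ L Λ Cη * h := by
  classical
  have hd0 : (0:ℝ) < d := by have : 0 < d := by omega
                             exact_mod_cast this
  have hd2 : (2:ℝ) ≤ d := by exact_mod_cast hd
  set w : EuclideanSpace ℝ (Fin d) → ℝ := fun x => Real.exp (V x) with hw
  have hw0 : ∀ x, 0 < w x := fun x => Real.exp_pos _
  have hAρ : ∀ x ∈ A, ‖x‖ ≤ ρ := by
    intro x hx
    by_contra hcon
    have := hηz x (not_le.mp hcon)
    rw [hηA x hx] at this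
    exact one_ne_zero this
  -- summability
  have hsA : ∀ f : EuclideanSpace ℝ (Fin d) → ℝ, Summable (fun z => A.indicator f (latP h z)) := by
    intro f
    apply lat_summable h ρ hh
    intro z hz
    exact indicator_of_notMem (fun hzA => absurd (hAρ _ hzA) (not_le.mpr hz)) _
  have hsG : Summable (fun z => ‖G (latP h z)‖ * w (latP h z)) := by
    apply lat_summable h ρ hh
    intro z hz
    rw [hGz _ hz]; simp
  have hsη : Summable (fun z => η (latP h z) * w (latP h z)) := by
    apply lat_summable h ρ hh
    intro z hz
    rw [hηz _ hz]; simp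
  have hle_ind : ∀ x, A.indicator w x ≤ η x * w x := by
    intro x
    by_cases hx : x ∈ A
    · rw [indicator_of_mem hx, hηA x hx, one_mul]
    · rw [indicator_of_notMem hx]; exact mul_nonneg (hη0 x) (hw0 x).le
  have hC1 : 0 ≤ cC1 L Λ := by unfold cC1; positivity
  have hC3 : 0 ≤ cC3 L Λ Cη := by unfold cC3; positivity
  have hC : 0 ≤ cC d ρ L Λ Cη := by unfold cC; positivity
  have ha0 : 0 ≤ a := by
    rw [ha]
    exact mul_nonneg (by positivity) (tsum_nonneg fun z => indicator_nonneg (fun x _ => (hw0 x).le) _)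
  set ω := volume.real (closedBall (0 : EuclideanSpace ℝ (Fin d)) 1) with hω
  have hωpos : 0 < ω := by
    rw [hω, measureReal_def]
    exact ENNReal.toReal_pos (measure_closedBall_pos _ _ one_pos).ne' measure_closedBall_lt_top.ne
  rcases ha0.eq_or_lt with ha00 | hapos
  · -- trivial case
    rw [← ha00, Real.zero_rpow (by
      have : (1:ℝ) / d ≤ 1 / 2 := one_div_le_one_div_of_le two_pos hd2
      linarith)]
    have h1 : 0 ≤ ∑' z, ‖G (latP h z)‖ * w (latP h z) :=
      tsum_nonneg fun z => mul_nonneg (norm_nonneg _) (hw0 _).le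
    have h2 : 0 ≤ ∑' z, η (latP h z) * w (latP h z) :=
      tsum_nonneg fun z => mul_nonneg (hη0 _) (hw0 _).le
    have h3 : 0 ≤ h ^ d := by positivity
    have := mul_nonneg h3 h1
    have := mul_nonneg hL (mul_nonneg h3 h2)
    have := mul_nonneg hC hh.le
    simp only [mul_zero, sub_zero]
    linarith
  -- finite index set
  have hfin : {z : Fin d → ℤ | latP h z ∈ A}.Finite :=
    (latBox d h ρ).finite_toSet.subset fun z hz => mem_latBox h ρ hh z (hAρ _ hz)
  set S : Finset (Fin d → ℤ) := hfin.toFinset with hS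
  have hSm : ∀ z, z ∈ S ↔ latP h z ∈ A := by intro z; simp [hS]
  have htsumA : ∀ f : EuclideanSpace ℝ (Fin d) → ℝ,
      ∑' z, A.indicator f (latP h z) = ∑ i : S, f (latP h i) := by
    intro f
    rw [tsum_eq_sum (s := S) (fun z hz => indicator_of_notMem (by rwa [hSm] at hz) _),
      ← Finset.sum_coe_sort S]
    exact Finset.sum_congr rfl fun i _ => indicator_of_mem ((hSm _).mp i.2) _
  have hSne : Nonempty S := by
    by_contra hcon
    rw [not_nonempty_iff] at hcon
    rw [htsumA, Finset.univ_eq_empty, Finset.sum_empty, mul_zero] at ha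
    exact hapos.ne' ha
  set m : S → ℝ := fun i => h ^ d * w (latP h i) * (ω / a) with hm
  have hmono : ∀ x y, 0 ≤ inner ℝ (x - y) (p x - p y) := by
    intro x y
    have h1 := hp x y
    have h2 := hp y x
    rw [real_inner_comm, inner_sub_left]
    rw [← neg_sub x y, inner_neg_right] at h1
    linarith
  have hmpos : ∀ i, 0 < m i := by
    intro i
    have := hw0 (latP h i)
    simp only [hm]; positivity
  have hmsum : ∑ i, m i = ω := by
    simp only [hm]
    rw [← Finset.sum_mul, ← Finset.mul_sum, ← htsumA w, ← ha]
    field_simp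
  have hxinj : Function.Injective (fun i : S => latP h (i : Fin d → ℤ)) :=
    fun i j hij => Subtype.ext (latP_inj h hh hij)
  have hpmon : ∀ i j : S, 0 ≤ inner ℝ (latP h (i : Fin d → ℤ) - latP h (j : Fin d → ℤ))
      (p (latP h (i : Fin d → ℤ)) - p (latP h (j : Fin d → ℤ))) := fun i j => hmono _ _
  have htm := transport_main (fun i : S => latP h (i : Fin d → ℤ)) hxinj m hmpos hmsum
    (fun i : S => p (latP h (i : Fin d → ℤ))) hpmon
  obtain ⟨φ, b, hb1, hb, hpb, hprod⟩ := htm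
  -- second differences
  set Δ : (Fin d → ℤ) → Fin d → ℝ := fun z k => (φ (latP h (z + Pi.single k 1)) +
    φ (latP h (z - Pi.single k 1)) - 2 * φ (latP h z)) / h with hΔ
  have hΔ0 : ∀ z k, 0 ≤ Δ z k := by
    intro z k
    simp only [hΔ]
    apply div_nonneg _ hh.le
    have h1 := hb (latP h z) (latP h (z + Pi.single k 1))
    have h2 := hb (latP h z) (latP h (z - Pi.single k 1))
    rw [latP_add, add_sub_cancel_left] at h1
    rw [latP_sub, sub_sub_cancel_left, inner_neg_right] at h2
    rw [latP_add, latP_sub]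
    linarith
  have hkey : ∀ z, latP h z ∈ A → d * (ω / a) ^ ((1:ℝ) / d) * h ≤ ∑ k, Δ z k := by
    intro z hz
    have h1 := hprod ⟨z, (hSm z).mpr hz⟩ h hh
    have h2 := amgm_fin (by omega) (Δ z) (hΔ0 z) (h ^ d * (ω / a)) (by positivity) (by
      refine le_trans ?_ (h1.trans (le_of_eq ?_))
      · simp only [hm]
        have : 1 ≤ w (latP h z) := Real.one_le_exp (hV0 _)
        have h3 : 0 ≤ h ^ d * (ω / a) := by positivity
        nlinarith
      · refine Finset.prod_congr rfl fun k _ => ?_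
        simp only [hΔ, latP_add, latP_sub])
    rw [Real.mul_rpow (by positivity) (by positivity), ← Real.rpow_natCast, ← Real.rpow_mul hh.le,
      mul_one_div_cancel hd0.ne', Real.rpow_one] at h2
    linarith
  set u : (Fin d → ℤ) → ℝ := fun z => η (latP h z) * w (latP h z) with hu
  have huz : ∀ z, ρ < ‖latP h z‖ → u z = 0 := by
    intro z hz; simp only [hu]; rw [hηz _ hz, zero_mul]
  have hufin : (Function.support u).Finite :=
    (latBox d h ρ).finite_toSet.subset fun z hz => mem_latBox h ρ hh z (by
      by_contra hcon
      exact hz (huz z (not_le.mp hcon)))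
  have hu0 : ∀ z, 0 ≤ u z := fun z => mul_nonneg (hη0 _) (hw0 _).le
  -- step 1
  have step1 : (d * (ω / a) ^ ((1:ℝ) / d) * h) * (∑' z, A.indicator w (latP h z)) ≤
      ∑' z, ∑ k, u z * Δ z k := by
    rw [← tsum_mul_left]
    apply Summable.tsum_le_tsum
    · intro z
      rw [← Finset.mul_sum]
      by_cases hz : latP h z ∈ A
      · rw [indicator_of_mem hz]
        simp only [hu]
        rw [hηA _ hz, one_mul, mul_comm]
        exact mul_le_mul_of_nonneg_left (hkey z hz) (hw0 _).le
      · rw [indicator_of_notMem hz, mul_zero]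
        exact mul_nonneg (hu0 z) (Finset.sum_nonneg fun k _ => hΔ0 z k)
    · exact (hsA w).mul_left _
    · apply lat_summable h ρ hh
      intro z hz
      simp [huz z hz]
  set T : (Fin d → ℤ) → Fin d → ℝ := fun z k =>
    -((u (z + Pi.single k 1) - u z) / h *
      ((φ (latP h (z + Pi.single k 1)) - φ (latP h z)) / h)) with hT
  have hTz : ∀ k z, ρ + 1 < ‖latP h z‖ → T z k = 0 := by
    intro k z hz
    simp only [hT]
    rw [huz z (by linarith), huz (z + Pi.single k 1) (by
      rw [latP_add]
      have := norm_sub_norm_le (latP h z) (-(h • EuclideanSpace.single k (1:ℝ)))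
      rw [sub_neg_eq_add, norm_neg, norm_smul] at this
      simp [abs_of_pos hh] at this
      linarith)]
    simp
  have hTs : ∀ k, Summable (fun z => T z k) := fun k => lat_summable h (ρ + 1) hh _ (hTz k)
  have huΔs : ∀ k, Summable (fun z => u z * Δ z k) := by
    intro k
    apply lat_summable h ρ hh
    intro z hz
    simp [huz z hz]
  have step2 : ∑' z, ∑ k, u z * Δ z k = h * ∑' z, ∑ k, T z k := by
    rw [Summable.tsum_finsetSum (fun k _ => huΔs k), Summable.tsum_finsetSum (fun k _ => hTs k),
      Finset.mul_sum]
    refine Finset.sum_congr rfl fun k _ => ?_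
    have := lat_ibp u (fun z => φ (latP h z)) hufin (Pi.single k 1)
    have e1 : ∀ z, u z * Δ z k = (1 / h) * (u z * (φ (latP h (z + Pi.single k 1)) +
      φ (latP h (z - Pi.single k 1)) - 2 * φ (latP h z))) := by
      intro z; simp only [hΔ]; ring
    have e2 : ∀ z, T z k = (1 / h ^ 2) * -((u (z + Pi.single k 1) - u z) *
      (φ (latP h (z + Pi.single k 1)) - φ (latP h z))) := by
      intro z; simp only [hT]; field_simp
    simp_rw [e1, e2]
    rw [tsum_mul_left, tsum_mul_left, this]
    field_simp
  -- error terms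
  set B : Fin d → (Fin d → ℤ) → ℝ := fun k z => if ‖latP h z‖ ≤ ρ + 1 then
      (b (latP h (z + Pi.single k 1))) k - (b (latP h z)) k else 0 with hB
  set Q : Fin d → (Fin d → ℤ) → ℝ := fun k z => if ‖latP h z‖ ≤ ρ + 1 then
      (p (latP h (z + Pi.single k 1))) k - (p (latP h z)) k else 0 with hQ
  set K : (Fin d → ℤ) → ℝ := fun z => if ‖latP h z‖ ≤ ρ + 1 then cC3 L Λ Cη * h else 0 with hK
  have hBs : ∀ k, Summable (B k) := fun k => lat_summable h (ρ + 1) hh _ (fun z hz => by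
    simp only [hB]; rw [if_neg (not_le.mpr hz)])
  have hQs : ∀ k, Summable (Q k) := fun k => lat_summable h (ρ + 1) hh _ (fun z hz => by
    simp only [hQ]; rw [if_neg (not_le.mpr hz)])
  have hKz : ∀ z, ρ + 1 < ‖latP h z‖ → K z = 0 := fun z hz => by
    simp only [hK]; rw [if_neg (not_le.mpr hz)]
  have hKs : Summable K := lat_summable h (ρ + 1) hh _ hKz
  have hcoord : ∀ (q : EuclideanSpace ℝ (Fin d)) z (k : Fin d),
      inner ℝ q (latP h (z + Pi.single k 1) - latP h z) = h * q k := by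
    intro q z k
    rw [latP_add, add_sub_cancel_left, inner_smul_right, EuclideanSpace.inner_single_right]; simp
  have hmonk : ∀ (ψ : EuclideanSpace ℝ (Fin d) → ℝ)
      (q : EuclideanSpace ℝ (Fin d) → EuclideanSpace ℝ (Fin d))
      (hq : ∀ x y, ψ x + inner ℝ (q x) (y - x) ≤ ψ y) (k : Fin d) z,
      (q (latP h z)) k ≤ (q (latP h (z + Pi.single k 1))) k := by
    intro ψ q hq k z
    have h1 := hq (latP h z) (latP h (z + Pi.single k 1))
    have h2 := hq (latP h (z + Pi.single k 1)) (latP h z)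
    rw [← neg_sub, inner_neg_right, hcoord] at h2
    rw [hcoord] at h1
    have : h * (q (latP h z)) k ≤ h * (q (latP h (z + Pi.single k 1))) k := by linarith
    exact le_of_mul_le_mul_left this hh
  have hBb : ∀ k, h ^ d * ∑' z, B k z ≤ h * 1 * (2 * (ρ + 1 + 3) + 1) ^ d := fun k =>
    lat_telescope h (ρ + 1) 1 hh hh1 (by linarith) zero_le_one b k (hmonk φ b hb k)
      (fun x _ => hb1 x)
  have hQb : ∀ k, h ^ d * ∑' z, Q k z ≤ h * L * (2 * (ρ + 1 + 3) + 1) ^ d := fun k =>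
    lat_telescope h (ρ + 1) L hh hh1 (by linarith) hL p k (hmonk V p hp k)
      (fun x hx => hpL x (by linarith))
  have hKb : h ^ d * ∑' z, K z ≤ cC3 L Λ Cη * h * (2 * (ρ + 1) + 1) ^ d :=
    lat_sum_bound h (ρ + 1) hh hh1 (by linarith) _ (by positivity) K hKz (fun z hz => by
      simp only [hK]; rw [if_pos hz])
  set M : (Fin d → ℤ) → ℝ := fun z => ‖G (latP h z)‖ * w (latP h z)
    - A.indicator (fun x => w x * inner ℝ (p x) (b x)) (latP h z)
    + L * (η (latP h z) * w (latP h z) - A.indicator w (latP h z)) with hM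
  have hMs : Summable M := (hsG.sub (hsA _)).add ((hsη.sub (hsA _)).mul_left L)
  set Er : Fin d → (Fin d → ℤ) → ℝ := fun k z =>
    cC1 L Λ * B k z + Real.exp L * Q k z + K z with hEr
  have hErs : ∀ k, Summable (Er k) := fun k =>
    (((hBs k).mul_left _).add ((hQs k).mul_left _)).add hKs
  have step3 : ∑' z, ∑ k, T z k ≤ ∑' z, (M z + ∑ k, Er k z) := by
    apply Summable.tsum_le_tsum
    · intro z
      have h1 : ∀ k ∈ Finset.univ, T z k ≤ _ := fun k _ =>
        disc_coord h ρ L Λ Cη hh hh1 hL hΛ V η φ p G b hp hVL hpL hη0 hη1 hηz hGz hl hg hb1 hb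
          (latP h z) k (latP h (z + Pi.single k 1)) (latP_add h z k)
      refine (Finset.sum_le_sum h1).trans ?_
      rw [Finset.sum_add_distrib]
      exact add_le_add (disc_point ρ L V η A p G b hpL hη0 hηA hηz hb1 (latP h z)) le_rfl
    · exact summable_sum fun k _ => hTs k
    · exact hMs.add (summable_sum fun k _ => hErs k)
  have hpb' : 0 ≤ h ^ d * ∑' z, A.indicator (fun x => w x * inner ℝ (p x) (b x)) (latP h z) := by
    rw [htsumA, Finset.mul_sum]
    have e : ∀ i : S, h ^ d * (w (latP h i) * inner ℝ (p (latP h i)) (b (latP h i))) =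
        (a / ω) * (m i * inner ℝ (p (latP h i)) (b (latP h i))) := by
      intro i; simp only [hm]; field_simp
    rw [Finset.sum_congr rfl fun i _ => e i, ← Finset.mul_sum]
    exact mul_nonneg (by positivity) hpb
  have hMsum : ∑' z, M z = ∑' z, ‖G (latP h z)‖ * w (latP h z)
    - ∑' z, A.indicator (fun x => w x * inner ℝ (p x) (b x)) (latP h z)
    + L * (∑' z, η (latP h z) * w (latP h z) - ∑' z, A.indicator w (latP h z)) := by
    simp only [hM]
    rw [(hsG.sub (hsA _)).tsum_add ((hsη.sub (hsA _)).mul_left L), hsG.tsum_sub (hsA _),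
      tsum_mul_left, hsη.tsum_sub (hsA _)]
  have hErsum : h ^ d * ∑' z, ∑ k, Er k z ≤ cC d ρ L Λ Cη * h := by
    rw [Summable.tsum_finsetSum (fun k _ => hErs k), Finset.mul_sum]
    have : ∀ k ∈ Finset.univ, h ^ d * ∑' z, Er k z ≤ 
        cC1 L Λ * (h * 1 * (2 * (ρ + 1 + 3) + 1) ^ d) +
        Real.exp L * (h * L * (2 * (ρ + 1 + 3) + 1) ^ d) +
        cC3 L Λ Cη * h * (2 * (ρ + 1) + 1) ^ d := by
      intro k _
      simp only [hEr]
      rw [(((hBs k).mul_left _).add ((hQs k).mul_left _)).tsum_add hKs,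
        ((hBs k).mul_left _).tsum_add ((hQs k).mul_left _), tsum_mul_left, tsum_mul_left]
      have h1 := mul_le_mul_of_nonneg_left (hBb k) hC1
      have h2 := mul_le_mul_of_nonneg_left (hQb k) (Real.exp_pos L).le
      have h3 := hKb
      calc _ = cC1 L Λ * (h ^ d * ∑' z, B k z) + Real.exp L * (h ^ d * ∑' z, Q k z) +
            h ^ d * ∑' z, K z := by ring
        _ ≤ _ := by linarith
    refine (Finset.sum_le_sum this).trans (le_of_eq ?_)
    rw [Finset.sum_const, Finset.card_univ, Fintype.card_fin, nsmul_eq_mul]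
    unfold cC; ring
  rw [hMs.tsum_add (summable_sum fun k _ => hErs k), hMsum] at step3
  -- combine
  have hfin1 : d * (ω / a) ^ ((1:ℝ) / d) * a ≤ h ^ d * ∑' z, ∑ k, T z k := by
    rw [step2] at step1
    have h1 : (d * (ω / a) ^ ((1:ℝ) / d)) * (∑' z, A.indicator w (latP h z)) ≤
        ∑' z, ∑ k, T z k := by
      apply le_of_mul_le_mul_left _ hh
      linarith
    calc _ = h ^ d * ((d * (ω / a) ^ ((1:ℝ) / d)) * (∑' z, A.indicator w (latP h z))) := by
          rw [mul_left_comm, ← ha]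
      _ ≤ _ := mul_le_mul_of_nonneg_left h1 (by positivity)
  have hlhs : d * ω ^ ((1:ℝ) / d) * a ^ (1 - (1:ℝ) / d) = d * (ω / a) ^ ((1:ℝ) / d) * a := by
    rw [Real.div_rpow hωpos.le hapos.le, Real.rpow_sub hapos, Real.rpow_one]
    field_simp
  rw [hlhs]
  refine hfin1.trans ((mul_le_mul_of_nonneg_left step3 (by positivity)).trans ?_)
  have ha' : L * (h ^ d * ∑' z, A.indicator w (latP h z)) = L * a := by rw [← ha]
  have hG' : ∑' z, ‖G (latP h z)‖ * Real.exp (V (latP h z)) =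
    ∑' z, ‖G (latP h z)‖ * w (latP h z) := rfl
  have hη' : tsum u = ∑' z, η (latP h z) * w (latP h z) := rfl
  calc _ = h ^ d * ∑' z, ‖G (latP h z)‖ * w (latP h z)
      - h ^ d * ∑' z, A.indicator (fun x => w x * inner ℝ (p x) (b x)) (latP h z)
      + L * (h ^ d * ∑' z, η (latP h z) * w (latP h z))
      - L * (h ^ d * ∑' z, A.indicator w (latP h z))
      + h ^ d * ∑' z, ∑ k, Er k z := by ring
    _ ≤ _ := by rw [ha', hG', hη']; linarith

end DiscreteMain

section Analytic

variable {d : ℕ}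

lemma convex_cont (V : EuclideanSpace ℝ (Fin d) → ℝ) (hV : ConvexOn ℝ Set.univ V) :
    Continuous V := by
  rw [← continuousOn_univ]
  exact hV.continuousOn isOpen_univ

lemma subgrad_exists (V : EuclideanSpace ℝ (Fin d) → ℝ) (hV : ConvexOn ℝ Set.univ V) :
    ∃ p : EuclideanSpace ℝ (Fin d) → EuclideanSpace ℝ (Fin d),
      ∀ x y, V x + inner ℝ (p x) (y - x) ≤ V y := by
  have hc := convex_cont V hV
  suffices h : ∀ x, ∃ p : EuclideanSpace ℝ (Fin d), ∀ y, V x + inner ℝ p (y - x) ≤ V y by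
    choose p hp using h
    exact ⟨p, hp⟩
  intro x
  have hconv : Convex ℝ {q : EuclideanSpace ℝ (Fin d) × ℝ | q.1 ∈ Set.univ ∧ V q.1 < q.2} :=
    hV.convex_strict_epigraph
  have hopen : IsOpen {q : EuclideanSpace ℝ (Fin d) × ℝ | q.1 ∈ Set.univ ∧ V q.1 < q.2} := by
    simp only [mem_univ, true_and]
    exact isOpen_lt (hc.comp continuous_fst) continuous_snd
  obtain ⟨f, hf⟩ := geometric_hahn_banach_open_point (x := (x, V x)) hconv hopen (by simp)
  set l : EuclideanSpace ℝ (Fin d) →L[ℝ] ℝ :=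
    f.comp (ContinuousLinearMap.inl ℝ (EuclideanSpace ℝ (Fin d)) ℝ) with hl
  set c : ℝ := f (0, 1) with hcdef
  have hft : ∀ (y : EuclideanSpace ℝ (Fin d)) (t : ℝ), f (y, t) = l y + t * c := by
    intro y t
    have : (y, t) = (y, (0:ℝ)) + t • ((0 : EuclideanSpace ℝ (Fin d)), (1:ℝ)) := by simp
    rw [this, map_add, map_smul]
    simp [hl, hcdef]
  have hlt : ∀ y t, V y < t → l y + t * c < l x + V x * c := by
    intro y t hyt
    have := hf (y, t) ⟨mem_univ _, hyt⟩
    rwa [hft, hft] at this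
  have hcneg : c < 0 := by
    have := hlt x (V x + 1) (by linarith)
    linarith
  have hle : ∀ y, l y + V y * c ≤ l x + V x * c := by
    intro y
    apply le_of_forall_pos_le_add
    intro ε hε
    have := hlt y (V y + ε / (-c)) (by have : 0 < ε / (-c) := div_pos hε (by linarith)
                                       linarith)
    have e : (V y + ε / (-c)) * c = V y * c - ε := by
      have hc0 : c ≠ 0 := hcneg.ne
      rw [div_neg, add_mul, neg_mul, div_mul_cancel₀ _ hc0]; ring
    rw [e] at this
    linarith
  refine ⟨(InnerProductSpace.toDual ℝ (EuclideanSpace ℝ (Fin d))).symm ((-c)⁻¹ • l), fun y => ?_⟩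
  rw [InnerProductSpace.toDual_symm_apply]
  simp only [smul_apply, map_sub, smul_eq_mul]
  have h1 := hle y
  have h2 : 0 < (-c)⁻¹ := inv_pos.mpr (by linarith)
  have h3 : (-c)⁻¹ * (l y - l x) ≤ (-c)⁻¹ * ((-c) * (V y - V x)) :=
    mul_le_mul_of_nonneg_left (by linarith) h2.le
  rw [inv_mul_cancel_left₀ (by linarith : (-c) ≠ 0)] at h3
  linarith

lemma bound_exists (V : EuclideanSpace ℝ (Fin d) → ℝ) (hV : Continuous V) (hV0 : ∀ x, 0 ≤ V x)
    (p : EuclideanSpace ℝ (Fin d) → EuclideanSpace ℝ (Fin d))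
    (hp : ∀ x y, V x + inner ℝ (p x) (y - x) ≤ V y) (R : ℝ) :
    ∃ L, 0 ≤ L ∧ (∀ x, ‖x‖ ≤ R → V x ≤ L) ∧ (∀ x, ‖x‖ ≤ R → ‖p x‖ ≤ L) := by
  obtain ⟨C, hC⟩ := (isCompact_closedBall (0 : EuclideanSpace ℝ (Fin d)) (R + 1)).exists_bound_of_continuousOn
    hV.continuousOn
  have hC' : ∀ x, ‖x‖ ≤ R + 1 → V x ≤ max C 0 := by
    intro x hx
    exact ((le_abs_self _).trans (hC x (by simpa using hx))).trans (le_max_left _ _)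
  refine ⟨max C 0, le_max_right _ _, fun x hx => hC' x (by linarith), fun x hx => ?_⟩
  by_cases hpx : p x = 0
  · rw [hpx, norm_zero]; exact le_max_right _ _
  have hn : 0 < ‖p x‖ := norm_pos_iff.mpr hpx
  have h1 := hp x (x + ‖p x‖⁻¹ • p x)
  rw [add_sub_cancel_left, inner_smul_right, real_inner_self_eq_norm_sq] at h1
  have e : ‖p x‖⁻¹ * ‖p x‖ ^ 2 = ‖p x‖ := by field_simp
  rw [e] at h1
  have h2 : ‖x + ‖p x‖⁻¹ • p x‖ ≤ R + 1 := by
    refine (norm_add_le _ _).trans (add_le_add hx ?_)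
    rw [norm_smul, norm_inv, norm_norm, inv_mul_cancel₀ hn.ne']
  linarith [hC' _ h2, hV0 x]

open scoped Pointwise in
lemma riemann_lim (f : EuclideanSpace ℝ (Fin d) → ℝ) (hf : Continuous f) (ρ : ℝ)
    (hfz : ∀ x, ρ < ‖x‖ → f x = 0) :
    Tendsto (fun n : ℕ => (1 / (n:ℝ)) ^ d * ∑' z, f (latP (1 / (n:ℝ)) z)) atTop
      (nhds (∫ x, f x)) := by
  set F : (Fin d → ℝ) → ℝ := fun x => f (WithLp.toLp 2 x) with hF
  have hFc : Continuous F := hf.comp (PiLp.continuous_toLp 2 _)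
  set s : Set (Fin d → ℝ) := closedBall 0 ρ with hs
  have hFs : ∀ x, x ∉ s → F x = 0 := by
    intro x hx
    apply hfz
    rw [hs, mem_closedBall_zero_iff, not_le] at hx
    refine hx.trans_le ?_
    rcases isEmpty_or_nonempty (Fin d) with he | he
    · have : x = 0 := Subsingleton.elim _ _
      rw [this]; simp
    · rw [pi_norm_le_iff_of_nonneg (norm_nonneg _)]
      intro i
      exact PiLp.norm_apply_le (WithLp.toLp 2 x) i
  have h := tendsto_tsum_div_pow_atTop_integral s F hFc isBounded_closedBall
    measurableSet_closedBall ((convex_closedBall 0 ρ).addHaar_frontier volume)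
  have e1 : ∫ x in s, F x = ∫ x, f x := by
    rw [setIntegral_eq_integral_of_forall_compl_eq_zero hFs]
    exact (PiLp.volume_preserving_toLp (Fin d)).integral_comp
      (MeasurableEquiv.toLp 2 (Fin d → ℝ)).measurableEmbedding f
  rw [e1] at h
  refine h.congr' ?_
  filter_upwards [eventually_gt_atTop 0] with n hn
  have hn' : (0:ℝ) < n := by exact_mod_cast hn
  set g : (Fin d → ℤ) → (Fin d → ℝ) := fun z k => (1 / (n:ℝ)) * (z k : ℝ) with hg
  have hgi : Function.Injective g := by
    intro z z' hz
    ext k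
    have := congrFun hz k
    simp only [hg] at this
    have h2 := mul_left_cancel₀ (by positivity) this
    exact_mod_cast h2
  have hr : ∀ z, g z ∈ ((n:ℝ)⁻¹ • (Submodule.span ℤ (Set.range (Pi.basisFun ℝ (Fin d))) :
      Set (Fin d → ℝ))) := by
    intro z
    rw [Set.mem_smul_set]
    refine ⟨fun k => (z k : ℝ), ?_, ?_⟩
    · rw [SetLike.mem_coe, Module.Basis.mem_span_iff_repr_mem]
      intro i
      simp
    · ext k; simp [hg]
  have hr' : ∀ x ∈ ((n:ℝ)⁻¹ • (Submodule.span ℤ (Set.range (Pi.basisFun ℝ (Fin d))) :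
      Set (Fin d → ℝ))), x ∈ Set.range g := by
    intro x hx
    rw [Set.mem_smul_set] at hx
    obtain ⟨y, hy, rfl⟩ := hx
    rw [SetLike.mem_coe, Module.Basis.mem_span_iff_repr_mem] at hy
    choose z hz using hy
    refine ⟨z, ?_⟩
    ext k
    have := hz k
    simp at this
    simp [hg, this]
  rw [Fintype.card_fin, tsum_subtype, ← hgi.tsum_eq (by
    intro x hx
    rw [Function.mem_support] at hx
    exact hr' x ((Set.mem_of_indicator_ne_zero hx).2))]
  rw [one_div, inv_pow, mul_comm, ← div_eq_mul_inv]
  congr 1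
  apply tsum_congr
  intro z
  have e2 : F (g z) = f (latP ((n:ℝ)⁻¹) z) := by simp [hF, hg, latP]
  rw [← e2]
  by_cases hz : g z ∈ s
  · rw [indicator_of_mem (Set.mem_inter hz (hr z))]
  · rw [indicator_of_notMem (fun hcon => hz hcon.1), hFs _ hz]

end Analytic

section LimitSec

variable {d : ℕ}

lemma limit_ineq (hd : 2 ≤ d) (ρ L Λ Cη : ℝ) (hρ : 0 ≤ ρ)
    (hL : 0 ≤ L) (hΛ : 0 ≤ Λ) (hCη : 0 ≤ Cη) (V η : EuclideanSpace ℝ (Fin d) → ℝ)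
    (A : Set (EuclideanSpace ℝ (Fin d))) (hA : IsOpen A)
    (p G : EuclideanSpace ℝ (Fin d) → EuclideanSpace ℝ (Fin d))
    (hVc : Continuous V) (hηc : Continuous η) (hGc : Continuous G)
    (hV0 : ∀ x, 0 ≤ V x)
    (hp : ∀ x y, V x + inner ℝ (p x) (y - x) ≤ V y)
    (hVL : ∀ x, ‖x‖ ≤ ρ + 4 → V x ≤ L) (hpL : ∀ x, ‖x‖ ≤ ρ + 4 → ‖p x‖ ≤ L)
    (hη0 : ∀ x, 0 ≤ η x) (hη1 : ∀ x, η x ≤ 1) (hηA : ∀ x ∈ A, η x = 1)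
    (hηz : ∀ x, ρ < ‖x‖ → η x = 0) (hGz : ∀ x, ρ < ‖x‖ → G x = 0)
    (hl : ∀ h, 0 < h → ∀ x (k : Fin d), |η (x + h • EuclideanSpace.single k 1) - η x| ≤ Λ * h)
    (hg : ∀ h, 0 < h → ∀ x (k : Fin d),
      |η (x + h • EuclideanSpace.single k 1) - η x - h * G x k| ≤ Cη * h ^ 2) :
    d * (volume.real (closedBall (0 : EuclideanSpace ℝ (Fin d)) 1)) ^ ((1:ℝ) / d) *
      (∫ x in A, Real.exp (V x)) ^ (1 - (1:ℝ) / d) ≤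
    (∫ x, ‖G x‖ * Real.exp (V x)) +
      L * ((∫ x, η x * Real.exp (V x)) - ∫ x in A, Real.exp (V x)) := by
  have hd2 : (2:ℝ) ≤ d := by exact_mod_cast hd
  have hexp : 0 < 1 - (1:ℝ) / d := by
    have : (1:ℝ) / d ≤ 1 / 2 := one_div_le_one_div_of_le two_pos hd2
    linarith
  set ω := volume.real (closedBall (0 : EuclideanSpace ℝ (Fin d)) 1) with hω
  have hω0 : 0 ≤ ω := measureReal_nonneg
  set w : EuclideanSpace ℝ (Fin d) → ℝ := fun x => Real.exp (V x) with hw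
  have hwc : Continuous w := Real.continuous_exp.comp hVc
  have hw0 : ∀ x, 0 < w x := fun x => Real.exp_pos _
  set Φ : ℝ → ℝ := fun t => d * ω ^ ((1:ℝ) / d) * t ^ (1 - (1:ℝ) / d) + L * t with hΦ
  have hΦc : Continuous Φ :=
    (continuous_const.mul (Real.continuous_rpow_const hexp.le)).add (continuous_const.mul continuous_id)
  have hΦm : ∀ s t, 0 ≤ s → s ≤ t → Φ s ≤ Φ t := by
    intro s t hs hst
    simp only [hΦ]
    have h1 := Real.rpow_le_rpow hs hst hexp.le
    have h2 : 0 ≤ d * ω ^ ((1:ℝ) / d) := by positivity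
    exact add_le_add (mul_le_mul_of_nonneg_left h1 h2) (mul_le_mul_of_nonneg_left hst hL)
  have hAρ : ∀ x ∈ A, ‖x‖ ≤ ρ := by
    intro x hx
    by_contra hcon
    have := hηz x (not_le.mp hcon)
    rw [hηA x hx] at this
    exact one_ne_zero this
  have hAc : (Aᶜ).Nonempty := by
    have hd0 : 0 < d := by omega
    refine ⟨EuclideanSpace.single ⟨0, hd0⟩ (ρ + 1), fun hx => ?_⟩
    have := hAρ _ hx
    rw [PiLp.norm_single, Real.norm_eq_abs, abs_of_pos (by linarith)] at this
    linarith
  -- approximating functions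
  set g : ℕ → EuclideanSpace ℝ (Fin d) → ℝ := fun k x => min 1 (k * infDist x Aᶜ) with hg'
  have hgc : ∀ k, Continuous (g k) := fun k =>
    continuous_const.min (continuous_const.mul (continuous_infDist_pt _))
  have hg0 : ∀ k x, 0 ≤ g k x := fun k x =>
    le_min zero_le_one (mul_nonneg (Nat.cast_nonneg _) infDist_nonneg)
  have hg1 : ∀ k x, g k x ≤ 1 := fun k x => min_le_left _ _
  have hgA : ∀ k x, x ∉ A → g k x = 0 := by
    intro k x hx
    simp only [hg']
    rw [infDist_zero_of_mem (show x ∈ Aᶜ from hx)]; simp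
  have hgz : ∀ k x, ρ < ‖x‖ → g k x * w x = 0 := by
    intro k x hx
    rw [hgA k x (fun hxA => absurd (hAρ x hxA) (not_le.mpr hx)), zero_mul]
  have hgw : ∀ k x, g k x * w x ≤ A.indicator w x := by
    intro k x
    by_cases hx : x ∈ A
    · rw [indicator_of_mem hx]; exact mul_le_of_le_one_left (hw0 x).le (hg1 k x)
    · rw [indicator_of_notMem hx, hgA k x hx, zero_mul]
  have hwint : IntegrableOn w A := by
    apply IntegrableOn.mono_set (t := closedBall 0 ρ)
    · exact hwc.continuousOn.integrableOn_compact (isCompact_closedBall _ _)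
    · intro x hx; simpa using hAρ x hx
  have hIw : Integrable (A.indicator w) := (integrable_indicator_iff hA.measurableSet).mpr hwint
  have hlimk : Tendsto (fun k => ∫ x, g k x * w x) atTop (nhds (∫ x in A, w x)) := by
    rw [← integral_indicator hA.measurableSet]
    apply tendsto_integral_of_dominated_convergence (A.indicator w)
    · intro k; exact ((hgc k).mul hwc).aestronglyMeasurable
    · exact hIw
    · intro k
      refine Eventually.of_forall fun x => ?_
      rw [Real.norm_eq_abs, abs_of_nonneg (mul_nonneg (hg0 k x) (hw0 x).le)]
      exact hgw k x
    · refine Eventually.of_forall fun x => ?_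
      by_cases hx : x ∈ A
      · rw [indicator_of_mem hx]
        have hpos : 0 < infDist x Aᶜ := by
          rw [← hA.isClosed_compl.notMem_iff_infDist_pos hAc]
          simpa using hx
        obtain ⟨N, hN⟩ := exists_nat_ge (1 / infDist x Aᶜ)
        apply tendsto_const_nhds.congr'
        filter_upwards [eventually_ge_atTop N] with k hk
        have : 1 ≤ (k:ℝ) * infDist x Aᶜ := by
          rw [← div_le_iff₀ hpos]
          exact hN.trans (by exact_mod_cast hk)
        simp only [hg']
        rw [min_eq_left this, one_mul]
      · rw [indicator_of_notMem hx]
        simp only [hgA _ x hx, zero_mul]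
        exact tendsto_const_nhds
  have hmain : ∀ k, Φ (∫ x, g k x * w x) ≤ (∫ x, ‖G x‖ * w x) + L * ∫ x, η x * w x := by
    intro k
    have r1 := riemann_lim (fun x => g k x * w x) ((hgc k).mul hwc) ρ (hgz k)
    have r2 := riemann_lim (fun x => ‖G x‖ * w x) (hGc.norm.mul hwc) ρ
      (fun x hx => by rw [hGz x hx]; simp)
    have r3 := riemann_lim (fun x => η x * w x) (hηc.mul hwc) ρ
      (fun x hx => by rw [hηz x hx]; simp)
    have r4 : Tendsto (fun n : ℕ => cC d ρ L Λ Cη * (1 / (n:ℝ))) atTop (nhds 0) := by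
      simpa using tendsto_one_div_atTop_nhds_zero_nat.const_mul (cC d ρ L Λ Cη)
    have l1 := (hΦc.tendsto _).comp r1
    have l2 := (r2.add (r3.const_mul L)).add r4
    rw [add_zero] at l2
    apply le_of_tendsto_of_tendsto l1 l2
    filter_upwards [eventually_gt_atTop 0] with n hn
    have hn1 : (1:ℝ) ≤ n := by exact_mod_cast hn
    have hh : (0:ℝ) < 1 / n := by positivity
    have hh1 : (1:ℝ) / n ≤ 1 := by rw [div_le_one (by linarith)]; exact hn1
    have key := discrete_ineq hd (1 / n) ρ L Λ Cη hh hh1 hρ hL hΛ hCη V η A p G hV0 hp hVL hpL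
      hη0 hη1 hηA hηz hGz (hl _ hh) (hg _ hh) _ rfl
    simp only [Function.comp]
    have hle : (1 / (n:ℝ)) ^ d * ∑' z, g k (latP (1 / (n:ℝ)) z) * w (latP (1 / (n:ℝ)) z) ≤
        (1 / (n:ℝ)) ^ d * ∑' z, A.indicator w (latP (1 / (n:ℝ)) z) := by
      apply mul_le_mul_of_nonneg_left _ (by positivity)
      apply Summable.tsum_le_tsum (fun z => hgw k _)
      · exact lat_summable _ ρ hh _ (fun z hz => hgz k _ hz)
      · exact lat_summable _ ρ hh _ (fun z hz => indicator_of_notMem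
          (fun hzA => absurd (hAρ _ hzA) (not_le.mpr hz)) _)
    have h0 : 0 ≤ (1 / (n:ℝ)) ^ d * ∑' z, g k (latP (1 / (n:ℝ)) z) * w (latP (1 / (n:ℝ)) z) :=
      mul_nonneg (by positivity) (tsum_nonneg fun z => mul_nonneg (hg0 k _) (hw0 _).le)
    refine (hΦm _ _ h0 hle).trans ?_
    simp only [hΦ]
    linarith
  have hfin := le_of_tendsto ((hΦc.tendsto _).comp hlimk) (Eventually.of_forall hmain)
  simp only [hΦ] at hfin
  linarith

end LimitSec

section Cutoff

variable {d : ℕ}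

/-- Lipschitz cutoff. -/
lemma cutoff_lip (A : Set (EuclideanSpace ℝ (Fin d))) (ε δ : ℝ)
    (hδε : 2 * δ < ε) : ∃ f : EuclideanSpace ℝ (Fin d) → ℝ,
      (∀ x, 0 ≤ f x) ∧ (∀ x, f x ≤ 1) ∧ (∀ x, infDist x A ≤ δ → f x = 1) ∧
      (∀ x, ε - δ ≤ infDist x A → f x = 0) ∧
      (∀ x y, |f x - f y| ≤ (ε - 2 * δ)⁻¹ * ‖x - y‖) := by
  have hc : 0 < ε - 2 * δ := by linarith
  refine ⟨fun x => max 0 (1 - max 0 (infDist x A - δ) * (ε - 2 * δ)⁻¹), fun x => le_max_left _ _,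
    fun x => ?_, fun x hx => ?_, fun x hx => ?_, fun x y => ?_⟩
  · apply max_le zero_le_one
    have : 0 ≤ max 0 (infDist x A - δ) * (ε - 2 * δ)⁻¹ :=
      mul_nonneg (le_max_left _ _) (inv_pos.mpr hc).le
    linarith
  · beta_reduce
    rw [max_eq_left (a := (0:ℝ)) (b := infDist x A - δ) (by linarith)]; simp
  · beta_reduce
    apply max_eq_left
    have h1 : ε - 2 * δ ≤ max 0 (infDist x A - δ) := le_trans (by linarith) (le_max_right _ _)
    have h2 := mul_le_mul_of_nonneg_right h1 (inv_pos.mpr hc).le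
    rw [mul_inv_cancel₀ hc.ne'] at h2
    linarith
  · beta_reduce
    have h1 : |max 0 (1 - max 0 (infDist x A - δ) * (ε - 2 * δ)⁻¹) -
        max 0 (1 - max 0 (infDist y A - δ) * (ε - 2 * δ)⁻¹)| ≤
        |(1 - max 0 (infDist x A - δ) * (ε - 2 * δ)⁻¹) -
          (1 - max 0 (infDist y A - δ) * (ε - 2 * δ)⁻¹)| := by
      simpa using abs_max_sub_max_le_max (0:ℝ) (1 - max 0 (infDist x A - δ) * (ε - 2 * δ)⁻¹) 0
        (1 - max 0 (infDist y A - δ) * (ε - 2 * δ)⁻¹)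
    refine h1.trans ?_
    have e : (1 - max 0 (infDist x A - δ) * (ε - 2 * δ)⁻¹) -
          (1 - max 0 (infDist y A - δ) * (ε - 2 * δ)⁻¹) =
          (ε - 2 * δ)⁻¹ * (-(max 0 (infDist x A - δ) - max 0 (infDist y A - δ))) := by ring
    rw [e, abs_mul, abs_of_pos (inv_pos.mpr hc), abs_neg]
    apply mul_le_mul_of_nonneg_left _ (inv_pos.mpr hc).le
    have h2 : |max 0 (infDist x A - δ) - max 0 (infDist y A - δ)| ≤
        |(infDist x A - δ) - (infDist y A - δ)| := by
      simpa using abs_max_sub_max_le_max (0:ℝ) (infDist x A - δ) 0 (infDist y A - δ)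
    refine h2.trans ?_
    rw [sub_sub_sub_cancel_right, abs_le]
    have h3 := infDist_le_infDist_add_dist (s := A) (x := x) (y := y)
    have h4 := infDist_le_infDist_add_dist (s := A) (x := y) (y := x)
    rw [dist_comm] at h4
    rw [dist_eq_norm] at h3 h4
    constructor <;> linarith

open scoped Convolution in
lemma eta_exists (A : Set (EuclideanSpace ℝ (Fin d))) (hA : A.Nonempty) (ε δ : ℝ) (hδ : 0 < δ)
    (hδε : 2 * δ < ε) : ∃ η : EuclideanSpace ℝ (Fin d) → ℝ, ContDiff ℝ 2 η ∧
      (∀ x, 0 ≤ η x) ∧ (∀ x, η x ≤ 1) ∧ (∀ x ∈ A, η x = 1) ∧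
      (∀ x, x ∉ thickening ε A → η x = 0) ∧
      (∀ x y, |η x - η y| ≤ (ε - 2 * δ)⁻¹ * ‖x - y‖) := by
  obtain ⟨f, hf0, hf1, hfA, hfz, hfl⟩ := cutoff_lip A ε δ hδε
  have hc : 0 < ε - 2 * δ := by linarith
  have hfc : Continuous f := by
    have : LipschitzWith ⟨(ε - 2 * δ)⁻¹, (inv_pos.mpr hc).le⟩ f := by
      apply LipschitzWith.of_dist_le_mul
      intro x y
      rw [Real.dist_eq, dist_eq_norm]
      exact hfl x y
    exact this.continuous
  let φ : ContDiffBump (0 : EuclideanSpace ℝ (Fin d)) := ⟨δ / 2, δ, by linarith, by linarith⟩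
  set ψ := φ.normed volume with hψ
  have hψc : Continuous ψ := φ.continuous_normed
  have hψ0 : ∀ x, 0 ≤ ψ x := fun x => φ.nonneg_normed x
  have hψi : Integrable ψ := φ.integrable_normed
  have hψ1 : ∫ x, ψ x = 1 := φ.integral_normed
  have hintg : ∀ x, Integrable (fun t => ψ t * f (x - t)) := by
    intro x
    apply hψi.mono' ((hψc.mul (hfc.comp (continuous_const.sub continuous_id))).aestronglyMeasurable)
    refine Eventually.of_forall fun t => ?_
    change |ψ t * f (x - t)| ≤ ψ t
    rw [abs_of_nonneg (mul_nonneg (hψ0 _) (hf0 _))]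
    exact mul_le_of_le_one_right (hψ0 _) (hf1 _)
  have hval : ∀ x, (ψ ⋆[ContinuousLinearMap.lsmul ℝ ℝ, volume] f) x = ∫ t, ψ t * f (x - t) := by
    intro x; rfl
  refine ⟨ψ ⋆[ContinuousLinearMap.lsmul ℝ ℝ, volume] f, ?_, ?_, ?_, ?_, ?_, ?_⟩
  · exact HasCompactSupport.contDiff_convolution_left (n := 2) _ φ.hasCompactSupport_normed
      (φ.contDiff_normed (n := 2)) hfc.locallyIntegrable
  · intro x
    rw [hval]
    exact integral_nonneg fun t => mul_nonneg (hψ0 _) (hf0 _)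
  · intro x
    rw [hval, ← hψ1]
    exact integral_mono (hintg x) hψi fun t => mul_le_of_le_one_right (hψ0 _) (hf1 _)
  · intro x hx
    have hball : ∀ y ∈ ball x φ.rOut, f y = 1 := by
      intro y hy
      apply hfA
      have h1 : dist y x < δ := hy
      exact (infDist_le_dist_of_mem hx).trans h1.le
    rw [hψ, φ.normed_convolution_eq_right (fun y hy => by
      rw [hball y hy, hball x (mem_ball_self φ.rOut_pos)])]
    exact hball x (mem_ball_self φ.rOut_pos)
  · intro x hx
    have hxd : ε ≤ infDist x A := by
      rw [mem_thickening_iff_infDist_lt hA, not_lt] at hx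
      exact hx
    have hball : ∀ y ∈ ball x φ.rOut, f y = 0 := by
      intro y hy
      apply hfz
      have h1 : dist y x < δ := hy
      have := infDist_le_infDist_add_dist (s := A) (x := x) (y := y)
      rw [dist_comm] at this
      linarith
    rw [hψ, φ.normed_convolution_eq_right (fun y hy => by
      rw [hball y hy, hball x (mem_ball_self φ.rOut_pos)])]
    exact hball x (mem_ball_self φ.rOut_pos)
  · intro x y
    rw [hval, hval, ← integral_sub (hintg x) (hintg y)]
    have hb : ∀ t, ‖ψ t * f (x - t) - ψ t * f (y - t)‖ ≤ ψ t * ((ε - 2 * δ)⁻¹ * ‖x - y‖) := by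
      intro t
      rw [← mul_sub, norm_mul, Real.norm_eq_abs, abs_of_nonneg (hψ0 t)]
      apply mul_le_mul_of_nonneg_left _ (hψ0 t)
      have := hfl (x - t) (y - t)
      rwa [sub_sub_sub_cancel_right] at this
    have := norm_integral_le_of_norm_le (hψi.mul_const _) (Eventually.of_forall hb)
    rw [integral_mul_const, hψ1, one_mul] at this
    exact this

/-- Second order Taylor bound. -/
lemma taylor_bound (η : EuclideanSpace ℝ (Fin d) → ℝ) (hη : ContDiff ℝ 2 η)
    (hs : HasCompactSupport η) :
    ∃ C : ℝ, 0 ≤ C ∧ ∀ x v, |η (x + v) - η x - fderiv ℝ η x v| ≤ C * ‖v‖ ^ 2 := by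
  have h1 : ContDiff ℝ 1 (fderiv ℝ η) := hη.fderiv_right (by norm_num)
  obtain ⟨C, hC⟩ := h1.lipschitzWith_of_hasCompactSupport (hs.fderiv ℝ) one_ne_zero
  refine ⟨C, C.2, fun x v => ?_⟩
  have := Convex.norm_image_sub_le_of_norm_fderiv_le' (𝕜 := ℝ) (f := η) (φ := fderiv ℝ η x)
    (s := closedBall x ‖v‖) (C := C * ‖v‖) (x := x) (y := x + v)
    (fun y _ => (hη.differentiable (by norm_num)) y)
    (fun y hy => by
      have h2 := hC.dist_le_mul y x
      rw [dist_eq_norm] at h2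
      exact h2.trans (mul_le_mul_of_nonneg_left hy C.2))
    (convex_closedBall _ _) (by simp) (by simp)
  rw [add_sub_cancel_left, Real.norm_eq_abs] at this
  linarith [this, sq ‖v‖]

end Cutoff

section Combine

variable {d : ℕ}

lemma combine_s (hd : 2 ≤ d) (r L : ℝ) (hr : 0 ≤ r)
    (hL : 0 ≤ L) (V : EuclideanSpace ℝ (Fin d) → ℝ)
    (A : Set (EuclideanSpace ℝ (Fin d))) (hA : IsOpen A) (hAne : A.Nonempty)
    (hAr : ∀ x ∈ A, ‖x‖ ≤ r)
    (p : EuclideanSpace ℝ (Fin d) → EuclideanSpace ℝ (Fin d))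
    (hVc : Continuous V) (hV0 : ∀ x, 0 ≤ V x)
    (hp : ∀ x y, V x + inner ℝ (p x) (y - x) ≤ V y)
    (hVL : ∀ x, ‖x‖ ≤ r + 1 + 4 → V x ≤ L) (hpL : ∀ x, ‖x‖ ≤ r + 1 + 4 → ‖p x‖ ≤ L)
    (ε δ : ℝ) (hε1 : ε ≤ 1) (hδ : 0 < δ) (hδε : 2 * δ < ε) :
    d * (volume.real (closedBall (0 : EuclideanSpace ℝ (Fin d)) 1)) ^ ((1:ℝ) / d) *
      (∫ x in A, Real.exp (V x)) ^ (1 - (1:ℝ) / d) ≤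
    ((ε - 2 * δ)⁻¹ + L) *
      ((∫ x in thickening ε A, Real.exp (V x)) - ∫ x in A, Real.exp (V x)) := by
  obtain ⟨η, hηs, hη0, hη1, hηA, hηT, hηl⟩ := eta_exists A hAne ε δ hδ hδε
  have hK : 0 < ε - 2 * δ := by linarith
  have hε : 0 < ε := by linarith
  have hT : ∀ x ∈ thickening ε A, ‖x‖ ≤ r + 1 := by
    intro x hx
    obtain ⟨z, hz, hxz⟩ := mem_thickening_iff.mp hx
    have h1 := hAr z hz
    rw [dist_eq_norm] at hxz
    have h2 : ‖x‖ ≤ ‖x - z‖ + ‖z‖ := by simpa using norm_add_le (x - z) z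
    linarith
  have hηz : ∀ x, r + 1 < ‖x‖ → η x = 0 := fun x hx =>
    hηT x fun h => absurd (hT x h) (not_le.mpr hx)
  have hcs : HasCompactSupport η := by
    apply HasCompactSupport.intro (isCompact_closedBall (0 : EuclideanSpace ℝ (Fin d)) (r + 1))
    intro x hx
    apply hηz
    simpa using hx
  obtain ⟨C, hC0, hC⟩ := taylor_bound η hηs hcs
  set G : EuclideanSpace ℝ (Fin d) → EuclideanSpace ℝ (Fin d) :=
    fun x => (InnerProductSpace.toDual ℝ (EuclideanSpace ℝ (Fin d))).symm (fderiv ℝ η x) with hG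
  have hGc : Continuous G :=
    (InnerProductSpace.toDual ℝ (EuclideanSpace ℝ (Fin d))).symm.continuous.comp
      (hηs.continuous_fderiv (by norm_num))
  have hGk : ∀ x (k : Fin d), G x k = fderiv ℝ η x (EuclideanSpace.single k 1) := by
    intro x k
    have h1 := InnerProductSpace.toDual_symm_apply (𝕜 := ℝ) (x := EuclideanSpace.single k (1:ℝ))
      (y := fderiv ℝ η x)
    rw [← h1, EuclideanSpace.inner_single_right]
    simp [hG]
  have hGn : ∀ x, ‖G x‖ = ‖fderiv ℝ η x‖ := fun x => by simp [hG]
  have hGK : ∀ x, ‖G x‖ ≤ (ε - 2 * δ)⁻¹ := by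
    intro x
    rw [hGn]
    apply norm_fderiv_le_of_lip' ℝ (inv_pos.mpr hK).le
    exact Eventually.of_forall fun y => hηl y x
  have hGA : ∀ x ∈ A, G x = 0 := by
    intro x hx
    have : fderiv ℝ η x = 0 := by
      apply IsLocalMax.fderiv_eq_zero
      exact Eventually.of_forall fun y => by rw [hηA x hx]; exact hη1 y
    simp [hG, this]
  have hGT : ∀ x, x ∉ thickening ε A → G x = 0 := by
    intro x hx
    have : fderiv ℝ η x = 0 := by
      apply IsLocalMin.fderiv_eq_zero
      exact Eventually.of_forall fun y => by rw [hηT x hx]; exact hη0 y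
    simp [hG, this]
  have hmain := limit_ineq hd (r + 1) L (ε - 2 * δ)⁻¹ C (by linarith) hL (inv_pos.mpr hK).le hC0
    V η A hA p G hVc hηs.continuous hGc hV0 hp hVL hpL hη0 hη1 hηA hηz
    (fun x hx => hGT x fun h => absurd (hT x h) (not_le.mpr hx))
    (fun h hh x k => by
      have := hηl (x + h • EuclideanSpace.single k 1) x
      rw [add_sub_cancel_left, norm_smul, EuclideanSpace.norm_single, norm_one, mul_one,
        Real.norm_eq_abs, abs_of_pos hh] at this
      exact this)
    (fun h hh x k => by
      have := hC x (h • EuclideanSpace.single k 1)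
      rw [norm_smul, EuclideanSpace.norm_single, norm_one, mul_one,
        Real.norm_eq_abs, abs_of_pos hh, map_smul, smul_eq_mul, ← hGk] at this
      exact this)
  have hwc : Continuous fun x => Real.exp (V x) := Real.continuous_exp.comp hVc
  have hAT : A ⊆ thickening ε A := self_subset_thickening hε A
  have hiT : IntegrableOn (fun x => Real.exp (V x)) (thickening ε A) := by
    apply IntegrableOn.mono_set
      (hwc.continuousOn.integrableOn_compact (isCompact_closedBall (0 : EuclideanSpace ℝ (Fin d)) (r + 1)))
    intro x hx
    simpa using hT x hx
  have hmT : MeasurableSet (thickening ε A) := isOpen_thickening.measurableSet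
  have h1 : ∫ x, ‖G x‖ * Real.exp (V x) ≤ (ε - 2 * δ)⁻¹ *
      ((∫ x in thickening ε A, Real.exp (V x)) - ∫ x in A, Real.exp (V x)) := by
    rw [← integral_diff hA.measurableSet hiT hAT, ← integral_const_mul,
      ← integral_indicator (hmT.diff hA.measurableSet)]
    apply integral_mono_of_nonneg
    · exact Eventually.of_forall fun x => mul_nonneg (norm_nonneg _) (Real.exp_pos _).le
    · rw [integrable_indicator_iff (hmT.diff hA.measurableSet)]
      exact (hiT.mono_set diff_subset).const_mul _
    · refine Eventually.of_forall fun x => ?_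
      by_cases hx : x ∈ thickening ε A \ A
      · simp only [Set.indicator_of_mem hx]
        exact mul_le_mul_of_nonneg_right (hGK x) (Real.exp_pos _).le
      · simp only [Set.indicator_of_notMem hx]
        have : G x = 0 := by
          by_cases hxT : x ∈ thickening ε A
          · apply hGA
            by_contra h
            exact hx ⟨hxT, h⟩
          · exact hGT x hxT
        simp [this]
  have h2 : ∫ x, η x * Real.exp (V x) ≤ ∫ x in thickening ε A, Real.exp (V x) := by
    rw [← integral_indicator hmT]
    apply integral_mono_of_nonneg
    · exact Eventually.of_forall fun x => mul_nonneg (hη0 _) (Real.exp_pos _).le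
    · rw [integrable_indicator_iff hmT]
      exact hiT
    · refine Eventually.of_forall fun x => ?_
      by_cases hx : x ∈ thickening ε A
      · simp only [Set.indicator_of_mem hx]
        exact mul_le_of_le_one_left (Real.exp_pos _).le (hη1 x)
      · simp only [Set.indicator_of_notMem hx]
        simp [hηT x hx]
  have h3 := mul_le_mul_of_nonneg_left (sub_le_sub_right h2 (∫ x in A, Real.exp (V x))) hL
  rw [add_mul]
  linarith

/-- The isoperimetric inequality at scale `ε`. -/
lemma combine_eps (hd : 2 ≤ d) (V : EuclideanSpace ℝ (Fin d) → ℝ)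
    (hV0 : ∀ x, 0 ≤ V x) (hV : ConvexOn ℝ Set.univ V)
    (A : Set (EuclideanSpace ℝ (Fin d))) (hA : IsOpen A) (hAne : A.Nonempty)
    (hAb : Bornology.IsBounded A) :
    ∃ L : ℝ, 0 ≤ L ∧ ∀ ε : ℝ, 0 < ε → ε ≤ 1 →
    d * (volume.real (closedBall (0 : EuclideanSpace ℝ (Fin d)) 1)) ^ ((1:ℝ) / d) *
      (∫ x in A, Real.exp (V x)) ^ (1 - (1:ℝ) / d) ≤
    (ε⁻¹ + L) * ((∫ x in thickening ε A, Real.exp (V x)) - ∫ x in A, Real.exp (V x)) := by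
  obtain ⟨r', hr'⟩ := hAb.exists_norm_le
  set r := max r' 0 with hr
  have hAr : ∀ x ∈ A, ‖x‖ ≤ r := fun x hx => (hr' x hx).trans (le_max_left _ _)
  obtain ⟨p, hp⟩ := subgrad_exists V hV
  have hVc := convex_cont V hV
  obtain ⟨L, hL, hVL, hpL⟩ := bound_exists V hVc hV0 p hp (r + 1 + 4)
  refine ⟨L, hL, fun ε hε hε1 => ?_⟩
  have ht : Tendsto (fun δ : ℝ => ((ε - 2 * δ)⁻¹ + L) *
      ((∫ x in thickening ε A, Real.exp (V x)) - ∫ x in A, Real.exp (V x)))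
      (nhdsWithin 0 (Ioi 0)) (nhds ((ε⁻¹ + L) *
      ((∫ x in thickening ε A, Real.exp (V x)) - ∫ x in A, Real.exp (V x)))) := by
    apply tendsto_nhdsWithin_of_tendsto_nhds
    apply Tendsto.mul_const
    apply Tendsto.add_const
    have : Tendsto (fun δ : ℝ => ε - 2 * δ) (nhds 0) (nhds ε) := by
      have h : Continuous fun δ : ℝ => ε - 2 * δ := by fun_prop
      simpa using h.tendsto 0
    exact this.inv₀ hε.ne'
  apply ge_of_tendsto ht
  have hev : ∀ᶠ δ : ℝ in nhdsWithin 0 (Ioi 0), δ ∈ Ioo (0:ℝ) (ε / 2) :=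
    Ioo_mem_nhdsGT (by linarith)
  filter_upwards [hev] with δ hδ
  exact combine_s hd r L (le_max_right _ _) hL V A hA hAne hAr p hVc hV0 hp hVL hpL ε δ hε1 hδ.1
    (by linarith [hδ.2])

end Combine

theorem stmt_18 (d : ℕ) (hd : 2 ≤ d) (V : EuclideanSpace ℝ (Fin d) → ℝ)
    (hVnonneg : ∀ x, 0 ≤ V x) (hVconv : ConvexOn ℝ Set.univ V)
    (A : Set (EuclideanSpace ℝ (Fin d)))
    (hAbd : Bornology.IsBounded A) (hAopen : IsOpen A) (hAsm : HasSmoothBoundary A) :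
    ENNReal.ofReal
        (((volume.withDensity fun x => ENNReal.ofReal (Real.exp (V x))) A).toReal
          ^ (1 - 1 / (d : ℝ))) ≤
      ENNReal.ofReal (kappa d) *
        surfaceMeasure (volume.withDensity fun x => ENNReal.ofReal (Real.exp (V x))) A := by
  have hVc := convex_cont V hVconv
  have hd2 : (2:ℝ) ≤ d := by exact_mod_cast hd
  have hexp : 0 < 1 - (1:ℝ) / d := by
    have : (1:ℝ) / d ≤ 1 / 2 := one_div_le_one_div_of_le two_pos hd2
    linarith
  rcases A.eq_empty_or_nonempty with hAe | hAne
  · subst hAe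
    rw [measure_empty, ENNReal.toReal_zero, Real.zero_rpow hexp.ne', ENNReal.ofReal_zero]
    exact zero_le
  set μ := (volume.withDensity fun x => ENNReal.ofReal (Real.exp (V x))) with hμ
  have hwc : Continuous fun x => Real.exp (V x) := Real.continuous_exp.comp hVc
  have hval : ∀ S : Set (EuclideanSpace ℝ (Fin d)), MeasurableSet S → Bornology.IsBounded S →
      μ S = ENNReal.ofReal (∫ x in S, Real.exp (V x)) := by
    intro S hS hSb
    rw [hμ, withDensity_apply _ hS, ofReal_integral_eq_lintegral_ofReal]
    · exact IntegrableOn.mono_set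
        (hwc.continuousOn.integrableOn_compact hSb.isCompact_closure) subset_closure
    · exact Eventually.of_forall fun x => (Real.exp_pos _).le
  obtain ⟨L, hL, hmain⟩ := combine_eps hd V hVnonneg hVconv A hAopen hAne hAbd
  set I := ∫ x in A, Real.exp (V x) with hI
  have hI0 : 0 ≤ I := integral_nonneg fun x => (Real.exp_pos _).le
  have hμA : μ A = ENNReal.ofReal I := hval A hAopen.measurableSet hAbd
  have hω : volume.real (closedBall (0 : EuclideanSpace ℝ (Fin d)) 1) =
      (volume (Metric.ball (0 : EuclideanSpace ℝ (Fin d)) 1)).toReal := by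
    rw [measureReal_def, Measure.addHaar_unitClosedBall_eq_addHaar_unitBall]
  have hωpos : 0 < (volume (Metric.ball (0 : EuclideanSpace ℝ (Fin d)) 1)).toReal :=
    ENNReal.toReal_pos (measure_ball_pos _ _ one_pos).ne' measure_ball_lt_top.ne
  rw [hω] at hmain
  set κ := (d:ℝ) * (volume (Metric.ball (0 : EuclideanSpace ℝ (Fin d)) 1)).toReal ^ ((1 : ℝ) / d)
    with hκ
  have hκpos : 0 < κ := mul_pos (by linarith) (Real.rpow_pos_of_pos hωpos _)
  have hkap : kappa d = 1 / κ := rfl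
  set c := κ * I ^ (1 - (1:ℝ) / d) with hc
  have hlim : ENNReal.ofReal c ≤ surfaceMeasure μ A := by
    have ht : Tendsto (fun ε : ℝ => ENNReal.ofReal (c / (1 + L * ε))) (nhdsWithin 0 (Ioi 0))
        (nhds (ENNReal.ofReal c)) := by
      apply ENNReal.tendsto_ofReal
      apply tendsto_nhdsWithin_of_tendsto_nhds
      have h1 : Tendsto (fun ε : ℝ => 1 + L * ε) (nhds 0) (nhds 1) := by
        have h : Continuous fun ε : ℝ => 1 + L * ε := by fun_prop
        simpa using h.tendsto 0
      have h2 := (tendsto_const_nhds (x := c)).div h1 one_ne_zero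
      rw [div_one] at h2
      exact h2
    rw [← ht.liminf_eq]
    unfold surfaceMeasure
    refine liminf_le_liminf ?_
    have hev : ∀ᶠ ε : ℝ in nhdsWithin 0 (Ioi 0), ε ∈ Ioo (0:ℝ) 1 := Ioo_mem_nhdsGT one_pos
    filter_upwards [hev] with ε hε
    have hε0 : 0 < ε := hε.1
    rw [hval _ isOpen_thickening.measurableSet hAbd.thickening, hμA, ← ENNReal.ofReal_sub _ hI0,
      ← ENNReal.ofReal_div_of_pos hε0]
    apply ENNReal.ofReal_le_ofReal
    have h1 := hmain ε hε0 hε.2.le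
    have h2 : 0 < 1 + L * ε := by positivity
    rw [div_le_div_iff₀ h2 hε0]
    have h3 := mul_le_mul_of_nonneg_right h1 hε0.le
    have h4 : (ε⁻¹ + L) * ((∫ x in thickening ε A, Real.exp (V x)) - I) * ε =
        ((∫ x in thickening ε A, Real.exp (V x)) - I) * (1 + L * ε) := by
      field_simp
    rw [h4] at h3
    exact h3
  calc ENNReal.ofReal ((μ A).toReal ^ (1 - 1 / (d : ℝ)))
      = ENNReal.ofReal (kappa d) * ENNReal.ofReal c := by
        rw [← ENNReal.ofReal_mul (by rw [hkap]; positivity), hkap, hμA, ENNReal.toReal_ofReal hI0]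
        congr 1
        rw [hc]
        field_simp
    _ ≤ _ := mul_le_mul_right hlim _
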